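/- arXiv:1307.0518 — 6 statements merged into one kernel-verified Lean document; each statement's English description precedes it below -/
import Mathlib

section
/- If det θ = −1, then H³(G, ℤ) ≅ ℤ/2. -/
/-- The automorphism of `ℤ²` (written multiplicatively) induced by a matrix `θ ∈ GL(2, ℤ)`. -/
noncomputable def torusAut (θ : GL (Fin 2) ℤ) : MulAut (Multiplicative (Fin 2 → ℤ)) :=
  AddEquiv.toMultiplicative
    ((LinearMap.GeneralLinearGroup.generalLinearEquiv ℤ (Fin 2 → ℤ)
      (Matrix.GeneralLinearGroup.toLin θ)).toAddEquiv)

/-- The action of `ℤ` on `ℤ²` in which the generator `1 ∈ ℤ` acts via `θ`. -/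
noncomputable def torusAction (θ : GL (Fin 2) ℤ) :
    Multiplicative ℤ →* MulAut (Multiplicative (Fin 2 → ℤ)) :=
  zpowersHom _ (torusAut θ)

/-- The fundamental group `G = ℤ² ⋊_θ ℤ` of the torus bundle with monodromy `θ`. -/
noncomputable def TorusBundleGroup (θ : GL (Fin 2) ℤ) : Type :=
  SemidirectProduct (Multiplicative (Fin 2 → ℤ)) (Multiplicative ℤ) (torusAction θ)

noncomputable instance (θ : GL (Fin 2) ℤ) : Group (TorusBundleGroup θ) :=
  inferInstanceAs (Group (SemidirectProduct _ _ _))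


open CategoryTheory groupCohomology

/-! ### The representation of `G` on functions `ℤ → ℤ` through `G → ℤ` -/

lemma rep_exact_of {k G : Type} [CommRing k] [Group G] (X : ShortComplex (Rep.{0} k G))
    (h : ∀ x, X.g.hom x = 0 → ∃ y, X.f.hom y = x) : X.Exact := by
  refine (ShortComplex.exact_map_iff_of_faithful _ (forget₂ (Rep.{0} k G) (ModuleCat.{0} k))).1 ?_
  rw [ShortComplex.moduleCat_exact_iff]
  exact h

section Shift
variable {G : Type} [Group G] (p : G →* Multiplicative ℤ)

noncomputable def shiftRepn : Representation ℤ G (ℤ → ℤ) where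
  toFun g := LinearMap.funLeft ℤ ℤ (fun k => k + (p g).toAdd)
  map_one' := by ext; simp [LinearMap.funLeft]
  map_mul' a b := by
    refine LinearMap.ext fun φ => funext fun k => ?_
    simp [LinearMap.funLeft, add_assoc]

noncomputable abbrev shiftRep : Rep ℤ G := Rep.of (shiftRepn p)

lemma shiftRepn_apply (g : G) (φ : ℤ → ℤ) (k : ℤ) :
    shiftRepn p g φ k = φ (k + (p g).toAdd) := rfl

noncomputable def constMap : Rep.trivial ℤ G ℤ ⟶ shiftRep p :=
  Rep.ofHom ⟨LinearMap.pi fun _ => LinearMap.id, fun g => by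
    refine LinearMap.ext fun m => funext fun k => ?_
    simp [shiftRepn_apply]⟩

lemma constMap_apply (m : ℤ) (k : ℤ) : (constMap p).hom m k = m := rfl

noncomputable def diffMap : shiftRep p ⟶ shiftRep p :=
  Rep.ofHom ⟨LinearMap.funLeft ℤ ℤ (fun k => k + 1) - LinearMap.id, fun g => by
    refine LinearMap.ext fun m => funext fun k => ?_
    simp [shiftRepn_apply, LinearMap.funLeft, add_right_comm]⟩

lemma diffMap_apply (φ : ℤ → ℤ) (k : ℤ) : (diffMap p).hom φ k = φ (k + 1) - φ k := rfl

noncomputable def shiftSeq : ShortComplex (Rep ℤ G) where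
  f := constMap p
  g := diffMap p
  zero := by
    refine Rep.hom_ext (Representation.IntertwiningMap.ext (LinearMap.ext fun m => funext fun k => ?_))
    change (diffMap p).hom ((constMap p).hom m) k = 0
    rw [diffMap_apply, constMap_apply, constMap_apply, sub_self]

lemma exists_antideriv (ψ : ℤ → ℤ) : ∃ φ : ℤ → ℤ, ∀ k, φ (k + 1) - φ k = ψ k := by
  refine ⟨fun k => Int.inductionOn' k 0 0 (fun n _ x => x + ψ n) (fun n _ x => x - ψ (n - 1)), ?_⟩
  intro k
  beta_reduce
  rcases le_or_gt 0 k with hk | hk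
  · rw [Int.inductionOn'_add_one (hz := hk)]; ring
  · have := Int.inductionOn'_sub_one (motive := fun _ => ℤ) (z := k+1) (b := 0) (zero := (0:ℤ))
      (succ := fun n _ x => x + ψ n) (pred := fun n _ x => x - ψ (n - 1)) (by omega)
    simp only [add_sub_cancel_right] at this
    rw [this]; ring

lemma shiftSeq_exact : (shiftSeq p).ShortExact where
  mono_f := (Rep.mono_iff_injective _).2 fun a b h => by
    have := congrFun h 0
    exact this
  epi_g := (Rep.epi_iff_surjective _).2 fun ψ => by
    obtain ⟨φ, h⟩ := exists_antideriv ψ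
    exact ⟨φ, funext h⟩
  exact := by
    refine rep_exact_of _ ?_
    intro (φ : ℤ → ℤ) h
    have h' : ∀ k, φ (k + 1) = φ k := fun k => sub_eq_zero.1 (congrFun h k)
    refine ⟨φ 0, funext fun k => ?_⟩
    change φ 0 = φ k
    induction k using Int.induction_on with
    | zero => rfl
    | succ i hi => rw [hi, h']
    | pred i hi => rw [hi, ← h' (-i - 1)]; simp

/-- The shift representation is coinduced from the kernel. -/
noncomputable def shiftIso (hp : Function.Surjective p) :
    shiftRep p ≅ Rep.coind p.ker.subtype (Rep.trivial ℤ p.ker ℤ) :=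
  Rep.mkIso <| .mk
    { toFun := fun φ => ⟨fun g => φ (p g).toAdd, fun s g => by
        have : p s = 1 := s.2
        simp [this]⟩
      map_add' := fun _ _ => rfl
      map_smul' := fun _ _ => rfl
      invFun := fun f k => f.1 (Function.surjInv hp (Multiplicative.ofAdd k))
      left_inv := fun φ => funext fun k => by simp [Function.surjInv_eq hp]
      right_inv := fun f => by
        refine Subtype.ext (funext fun g => ?_)
        have h := f.2 ⟨Function.surjInv hp (p g) * g⁻¹, by
          simp [MonoidHom.mem_ker, Function.surjInv_eq hp]⟩ g
        simpa using h } fun g => by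
    refine LinearMap.ext fun φ => Subtype.ext (funext fun x => ?_)
    simp [shiftRepn_apply, LinearMap.funLeft]

noncomputable def shapiroShift (hp : Function.Surjective p) (n : ℕ) :
    groupCohomology (shiftRep p) n ≅ groupCohomology (Rep.trivial ℤ p.ker ℤ) n :=
  (groupCohomology.functor ℤ G n).mapIso (shiftIso p hp) ≪≫ coindIso _ n

lemma isZero_step (hp : Function.Surjective p) (n : ℕ)
    (h1 : Limits.IsZero (groupCohomology (Rep.trivial ℤ p.ker ℤ) n))
    (h2 : Limits.IsZero (groupCohomology (Rep.trivial ℤ p.ker ℤ) (n + 1))) :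
    Limits.IsZero (groupCohomology (Rep.trivial ℤ G ℤ) (n + 1)) := by
  have h := mapShortComplex₁_exact (shiftSeq_exact p) (i := n) (j := n + 1) rfl
  exact h.isZero_of_both_zeros
    ((h1.of_iso (shapiroShift p hp n)).eq_of_src _ _)
    ((h2.of_iso (shapiroShift p hp (n + 1))).eq_of_tgt _ _)

end Shift

section Cocycle
variable {G : Type} [Group G] {A : Rep ℤ G} (f : cocycles₂ A)

lemma cocycle_conj (t x y x' y' : G) (hx : t * x = x' * t) (hy : t * y = y' * t)
    (hxy : x * y = y * x) (hx' : A.ρ x' = 1) (hy' : A.ρ y' = 1) :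
    A.ρ t (f (x, y) - f (y, x)) = f (x', y') - f (y', x') := by
  have hxy' : x' * y' = y' * x' := by
    have e1 : x' = t * x * t⁻¹ := by simp [hx]
    have e2 : y' = t * y * t⁻¹ := by simp [hy]
    rw [e1, e2]
    have : t * (x * y) * t⁻¹ = t * (y * x) * t⁻¹ := by rw [hxy]
    simpa [mul_assoc] using this
  have H := (mem_cocycles₂_iff (f : G × G → A)).1 f.2
  have a1 := H t x y
  have a2 := H t y x
  have b1 := H x' t y
  have b2 := H y' t x
  have c1 := H x' y' t
  have c2 := H y' x' t
  simp only [hx', hy', Module.End.one_apply, hx, hy] at a1 a2 b1 b2 c1 c2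
  rw [hxy] at a1
  rw [hxy'] at c1
  rw [map_sub]
  linear_combination (norm := module) -a1 + a2 + b1 - b2 - c1 + c2

lemma cocycle_add (x y z : G) 
    (hxy : x * y = y * x) (hyz : z * y = y * z) (hx : A.ρ x = 1) (hy : A.ρ y = 1) :
    f (x * z, y) - f (y, x * z) = (f (x, y) - f (y, x)) + (f (z, y) - f (y, z)) := by
  have H := (mem_cocycles₂_iff (f : G × G → A)).1 f.2
  have a1 := H x z y
  have a2 := H y x z
  have a3 := H x y z
  simp only [hx, hy, Module.End.one_apply] at a1 a2 a3
  rw [hyz] at a1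
  rw [hxy] at a3
  linear_combination (norm := module) a1 + a2 - a3

/-- The commutator pairing of a cocycle, along a homomorphism from `ℤ²`. -/
noncomputable def commPairing (i : Multiplicative (Fin 2 → ℤ) →* G) (_hi : ∀ v, A.ρ (i v) = 1)
    (l : A →+ ℤ) (v w : Fin 2 → ℤ) : ℤ :=
  l (f (i (.ofAdd v), i (.ofAdd w)) - f (i (.ofAdd w), i (.ofAdd v)))

variable (i : Multiplicative (Fin 2 → ℤ) →* G) (hi : ∀ v, A.ρ (i v) = 1) (l : A →+ ℤ)

lemma commPairing_add (u v w : Fin 2 → ℤ) : commPairing f i hi l (u + v) w =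
    commPairing f i hi l u w + commPairing f i hi l v w := by
  simp only [commPairing, ofAdd_add, map_mul]
  rw [cocycle_add f _ _ _ (by rw [← map_mul, mul_comm, map_mul]) (by rw [← map_mul, mul_comm, map_mul]) (hi _) (hi _),
    map_add]

lemma commPairing_swap (v w : Fin 2 → ℤ) : commPairing f i hi l v w =
    - commPairing f i hi l w v := by
  simp [commPairing]

lemma alternating_formula (B : (Fin 2 → ℤ) → (Fin 2 → ℤ) → ℤ)
    (hadd : ∀ u v w, B (u + v) w = B u w + B v w) (hswap : ∀ v w, B v w = - B w v)
    (v w : Fin 2 → ℤ) :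
    B v w = (v 0 * w 1 - v 1 * w 0) * B ![1, 0] ![0, 1] := by
  have hadd' : ∀ u v w, B w (u + v) = B w u + B w v := fun u v w => by
    rw [hswap, hadd, hswap u, hswap v]; ring
  have hs : ∀ (n : ℤ) u w, B (n • u) w = n * B u w := fun n u w => by
    let φ : (Fin 2 → ℤ) →+ ℤ := AddMonoidHom.mk' (fun u => B u w) (fun a b => hadd a b w)
    exact (map_zsmul φ n u).trans (smul_eq_mul _ _)
  have hs' : ∀ (n : ℤ) u w, B w (n • u) = n * B w u := fun n u w => by
    rw [hswap, hs, hswap u]; ring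
  have hself : ∀ u, B u u = 0 := fun u => by have := hswap u u; omega
  have hv : ∀ v : Fin 2 → ℤ, v = v 0 • ![1, 0] + v 1 • ![0, 1] := fun v => by
    ext j; fin_cases j <;> simp
  have h10 := hswap ![0, 1] ![1, 0]
  conv_lhs => rw [hv v, hv w]
  simp only [hadd, hadd', hs, hs', hself, h10]
  ring

lemma coboundary_comm (h : (f : G × G → A) ∈ coboundaries₂ A) (x y : G) (hxy : x * y = y * x)
    (hx : A.ρ x = 1) (hy : A.ρ y = 1) : f (x, y) - f (y, x) = 0 := by
  obtain ⟨c, hc⟩ := h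
  rw [← hc]
  simp [hx, hy, hxy]
  abel

end Cocycle

section Split

/-- Type synonym for the extension defined by a symmetric cocycle. -/
def ExtTy (_f : (Fin 2 → ℤ) → (Fin 2 → ℤ) → ℤ) : Type := ℤ × (Fin 2 → ℤ)

variable {f : (Fin 2 → ℤ) → (Fin 2 → ℤ) → ℤ}

instance : Add (ExtTy f) := ⟨fun a b => (a.1 + b.1 + f a.2 b.2, a.2 + b.2)⟩
instance : Zero (ExtTy f) := ⟨(- f 0 0, 0)⟩
instance : Neg (ExtTy f) := ⟨fun a => (- a.1 - f a.2 (-a.2) - f 0 0, -a.2)⟩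

@[reducible] def extGroup (hs : ∀ x y, f x y = f y x)
    (hc : ∀ x y z, f (x + y) z + f x y = f y z + f x (y + z)) : AddCommGroup (ExtTy f) :=
  have h0 : ∀ x, f 0 x = f 0 0 := fun x => by
    have := hc 0 0 x
    simp only [zero_add] at this
    omega
  { AddGroup.ofLeftAxioms (G := ExtTy f)
      (fun a b c => Prod.ext (by
        change a.1 + b.1 + f a.2 b.2 + c.1 + f (a.2 + b.2) c.2 =
          a.1 + (b.1 + c.1 + f b.2 c.2) + f a.2 (b.2 + c.2)
        have := hc a.2 b.2 c.2
        omega) (add_assoc a.2 b.2 c.2))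
      (fun a => Prod.ext (by
        change - f 0 0 + a.1 + f 0 a.2 = a.1
        have := h0 a.2
        omega) (zero_add a.2))
      (fun a => Prod.ext (by
        change - a.1 - f a.2 (-a.2) - f 0 0 + a.1 + f (-a.2) a.2 = - f 0 0
        rw [hs (-a.2)]; ring) (neg_add_cancel a.2)) with
    add_comm := fun a b => Prod.ext (by
      change a.1 + b.1 + f a.2 b.2 = b.1 + a.1 + f b.2 a.2
      rw [hs a.2]; ring) (add_comm a.2 b.2) }

lemma symm_cocycle_split (hs : ∀ x y, f x y = f y x)
    (hc : ∀ x y z, f (x + y) z + f x y = f y z + f x (y + z)) :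
    ∃ h : (Fin 2 → ℤ) → ℤ, ∀ x y, f x y = h y - h (x + y) + h x := by
  let _ := extGroup hs hc
  let q : ExtTy f →+ (Fin 2 → ℤ) := AddMonoidHom.mk' (fun a => a.2) (fun _ _ => rfl)
  have hq : Function.Surjective q.toIntLinearMap := fun v => ⟨((0 : ℤ), v), rfl⟩
  obtain ⟨s, hs'⟩ := Module.projective_lifting_property q.toIntLinearMap LinearMap.id hq
  have h2 : ∀ v, (s v).2 = v := fun v => LinearMap.congr_fun hs' v
  refine ⟨fun v => - (s v).1, fun x y => ?_⟩
  have : (s (x + y)).1 = (s x).1 + (s y).1 + f (s x).2 (s y).2 :=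
    congrArg Prod.fst (s.map_add x y)
  rw [h2, h2] at this
  linarith

end Split

section H2
variable {S : Type} [Group S]

noncomputable def commFun {G : Type} [Group G] (A : Rep ℤ G) (l : A →+ ℤ) (a b : G) :
   cocycles₂ A →+ ℤ :=
  AddMonoidHom.mk' (fun f => l (f (a, b) - f (b, a))) (fun f g => by
    change l (f (a, b) + g (a, b) - (f (b, a) + g (b, a))) = _
    rw [add_sub_add_comm, map_add])

lemma h2_iso (e : Multiplicative (Fin 2 → ℤ) ≃* S) : Nonempty (groupCohomology (Rep.trivial ℤ S ℤ) 2 ≃+ ℤ) := by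
  let A := Rep.trivial ℤ S ℤ
  let Ψ := commFun A (AddMonoidHom.id ℤ) (e (.ofAdd ![1, 0])) (e (.ofAdd ![0, 1]))
  have hsurj : Function.Surjective Ψ := by
    intro m
    refine ⟨⟨fun x => m * ((e.symm x.1).toAdd 0 * (e.symm x.2).toAdd 1), ?_⟩, ?_⟩
    · rw [mem_cocycles₂_iff]
      intro g h j
      simp
      ring
    · change m * _ - m * _ = m
      simp
  let P : cocycles₂ A →+ groupCohomology A 2 := (H2π A).hom.toAddMonoidHom
  have hP : Function.Surjective P := (ModuleCat.epi_iff_surjective _).1 inferInstance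
  have hker : P.ker = Ψ.ker := by
    ext f
    rw [AddMonoidHom.mem_ker, AddMonoidHom.mem_ker]
    refine (H2π_eq_zero_iff f).trans ⟨fun h => ?_, fun h => ?_⟩
    · exact coboundary_comm f h _ _ (by rw [← map_mul, mul_comm, map_mul]) rfl rfl
    · have hi : ∀ v, A.ρ (e.toMonoidHom v) = 1 := fun _ => rfl
      have H := alternating_formula _ (commPairing_add f e.toMonoidHom hi (AddMonoidHom.id ℤ))
        (commPairing_swap f e.toMonoidHom hi (AddMonoidHom.id ℤ))
      have h0 : commPairing f e.toMonoidHom hi (AddMonoidHom.id ℤ) ![1, 0] ![0, 1] = 0 := h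
      simp only [h0, mul_zero] at H
      obtain ⟨c, hc⟩ := symm_cocycle_split (f := fun x y => f (e (.ofAdd x), e (.ofAdd y)))
        (fun x y => sub_eq_zero.1 (H x y))
        (fun x y z => by
          have := (mem_cocycles₂_iff (f : S × S → A)).1 f.2 (e (.ofAdd x)) (e (.ofAdd y)) (e (.ofAdd z))
          rw [← map_mul e, ← map_mul e] at this
          exact this)
      refine ⟨fun s => c (e.symm s).toAdd, funext fun x => ?_⟩
      have := hc (e.symm x.1).toAdd (e.symm x.2).toAdd
      simp only [ofAdd_toAdd, MulEquiv.apply_symm_apply] at this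
      refine Eq.trans ?_ this.symm
      simp [A]
  exact ⟨(QuotientAddGroup.quotientKerEquivOfSurjective P hP).symm.trans
    ((QuotientAddGroup.quotientAddEquivOfEq hker).trans
      (QuotientAddGroup.quotientKerEquivOfSurjective Ψ hsurj))⟩
end H2

section Main
variable {G : Type} [Group G] (p : G →* Multiplicative ℤ)

/-- The algebraic end of the argument. -/
lemma coker_zmod {H H' : Type} [AddCommGroup H] [AddCommGroup H'] (e : H ≃+ ℤ)
    (D : H →+ H) (δ : H →+ H') (hδ : Function.Surjective δ)
    (hex : ∀ x, δ x = 0 ↔ ∃ y, D y = x) (hD : ∀ x, D x = (-2 : ℤ) • x) :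
    Nonempty (H' ≃+ ZMod 2) := by
  let q : ℤ →+ H' := δ.comp e.symm.toAddMonoidHom
  have hq : Function.Surjective q := hδ.comp e.symm.surjective
  have hk : AddSubgroup.zmultiples ((2 : ℕ) : ℤ) = q.ker := by
    ext n
    rw [AddMonoidHom.mem_ker, Int.mem_zmultiples_iff]
    refine Iff.trans ?_ (hex (e.symm n)).symm
    constructor
    · rintro ⟨m, rfl⟩
      refine ⟨e.symm (-m), ?_⟩
      rw [hD, ← map_zsmul]
      congr 1
      simp
    · rintro ⟨y, hy⟩
      rw [hD] at hy
      have := congrArg e hy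
      rw [map_zsmul, AddEquiv.apply_symm_apply] at this
      exact ⟨- e y, by rw [← this]; simp⟩
  exact ⟨((Int.quotientZMultiplesNatEquivZMod 2).symm.trans
    ((QuotientAddGroup.quotientAddEquivOfEq hk).trans
      (QuotientAddGroup.quotientKerEquivOfSurjective q hq))).symm⟩

lemma end_eq {H : Type} [AddCommGroup H] (e : H ≃+ ℤ) (D : H →+ H) (Φ : H →+ ℤ) (c : ℤ)
    (hΦ : ∀ x, Φ (D x) = c * Φ x) (x₀ : H) (h0 : Φ x₀ ≠ 0) (x : H) : D x = c • x := by
  have hx : ∀ x, x = e x • e.symm 1 := fun x => by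
    apply e.injective; rw [map_zsmul]; simp
  have hg : Φ (e.symm 1) ≠ 0 := fun h => h0 (by rw [hx x₀, map_zsmul, h, smul_zero])
  have h1 : D (e.symm 1) = c • e.symm 1 := by
    rw [hx (D (e.symm 1))]
    congr 1
    have := hΦ (e.symm 1)
    rw [hx (D (e.symm 1)), map_zsmul, smul_eq_mul] at this
    exact mul_right_cancel₀ hg this
  rw [hx x, map_zsmul, h1, smul_comm]

/-- Evaluation at an integer. -/
def evHom (k : ℤ) : shiftRep p →+ ℤ := Pi.evalAddMonoidHom (fun _ : ℤ => ℤ) k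

lemma h3_of (e : groupCohomology (shiftRep p) 2 ≃+ ℤ)
    (h3 : Limits.IsZero (groupCohomology (shiftRep p) 3))
    (i : Multiplicative (Fin 2 → ℤ) →* G) (hpi : ∀ v, p (i v) = 1)
    (t : G) (ht : p t = .ofAdd 1) (T : (Fin 2 → ℤ) → (Fin 2 → ℤ))
    (hT : ∀ v, t * i (.ofAdd v) = i (.ofAdd (T v)) * t)
    (hdet : T ![1, 0] 0 * T ![0, 1] 1 - T ![1, 0] 1 * T ![0, 1] 0 = -1)
    (f₀ : cocycles₂ (shiftRep p))
    (hf₀ : commFun (shiftRep p) (evHom p 0) (i (.ofAdd ![1, 0])) (i (.ofAdd ![0, 1])) f₀ ≠ 0) :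
    Nonempty (groupCohomology (Rep.trivial ℤ G ℤ) 3 ≃+ ZMod 2) := by
  let A := shiftRep p
  let l : A →+ ℤ := evHom p 0
  have hi : ∀ v, A.ρ (i v) = 1 := fun v => by
    refine LinearMap.ext fun φ => funext fun k => ?_
    change φ (k + (p (i v)).toAdd) = φ k
    simp [hpi]
  have hcomm : ∀ v w, i v * i w = i w * i v := fun v w => by rw [← map_mul, mul_comm, map_mul]
  let Ψ := commFun A l (i (.ofAdd ![1, 0])) (i (.ofAdd ![0, 1]))
  let P : cocycles₂ A →+ groupCohomology A 2 := (H2π A).hom.toAddMonoidHom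
  have hP : Function.Surjective P := (ModuleCat.epi_iff_surjective _).1 inferInstance
  have hker : P.ker ≤ Ψ.ker := by
    intro f hf
    have hf' := (H2π_eq_zero_iff f).1 hf
    have := coboundary_comm f hf' _ _ (hcomm (.ofAdd ![1, 0]) (.ofAdd ![0, 1])) (hi _) (hi _)
    exact (congrArg l this).trans (map_zero l)
  let Φ : groupCohomology A 2 →+ ℤ := P.liftOfSurjective hP ⟨Ψ, hker⟩
  have hΦP : ∀ f, Φ (P f) = Ψ f := fun f =>
    P.liftOfRightInverse_comp_apply _ _ ⟨Ψ, hker⟩ f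
  let D : groupCohomology A 2 →+ groupCohomology A 2 :=
    (map (A := shiftRep p) (B := shiftRep p) (MonoidHom.id G) (diffMap p) 2).hom.toAddMonoidHom
  have hDP : ∀ f, D (P f) = P (mapCocycles₂ (A := shiftRep p) (B := shiftRep p) (MonoidHom.id G) (diffMap p) f) := fun f =>
    H2π_comp_map_apply (A := shiftRep p) (B := shiftRep p) (MonoidHom.id G) (diffMap p) f
  have hΨ : ∀ f : cocycles₂ A, Ψ (mapCocycles₂ (A := shiftRep p) (B := shiftRep p) (MonoidHom.id G) (diffMap p) f) = -2 * Ψ f := by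
    intro f
    have hconj := cocycle_conj f t _ _ _ _ (hT ![1, 0]) (hT ![0, 1]) (hcomm _ _) (hi _) (hi _)
    have hconj0 := congrArg (evHom p 0) hconj
    have halt := alternating_formula _ (commPairing_add f i hi l) (commPairing_swap f i hi l)
      (T ![1, 0]) (T ![0, 1])
    rw [hdet] at halt
    have e1 : Ψ f = commPairing f i hi l ![1, 0] ![0, 1] := rfl
    rw [← e1] at halt
    have e2 : commPairing f i hi l (T ![1, 0]) (T ![0, 1]) =
      evHom p 1 (f (i (.ofAdd ![1, 0]), i (.ofAdd ![0, 1]))) -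
      evHom p 1 (f (i (.ofAdd ![0, 1]), i (.ofAdd ![1, 0]))) := by
      refine Eq.trans hconj0.symm ?_
      have key : ∀ ψ : shiftRep p, evHom p 0 ((shiftRep p).ρ t ψ) = evHom p 1 ψ := fun ψ => by
        change (ψ : ℤ → ℤ) (0 + (p t).toAdd) = (ψ : ℤ → ℤ) 1
        rw [ht]
        rfl
      refine (key _).trans (map_sub _ _ _)
    have key2 : ∀ ψ : shiftRep p, evHom p 0 ((diffMap p).hom ψ) = evHom p 1 ψ - evHom p 0 ψ :=
      fun ψ => rfl
    have e3 : Ψ (mapCocycles₂ (A := shiftRep p) (B := shiftRep p) (MonoidHom.id G) (diffMap p) f) = evHom p 0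
        ((diffMap p).hom (f (i (.ofAdd ![1, 0]), i (.ofAdd ![0, 1]))) -
          (diffMap p).hom (f (i (.ofAdd ![0, 1]), i (.ofAdd ![1, 0])))) := rfl
    have e4 : Ψ f = evHom p 0 (f (i (.ofAdd ![1, 0]), i (.ofAdd ![0, 1])) -
      f (i (.ofAdd ![0, 1]), i (.ofAdd ![1, 0]))) := rfl
    rw [map_sub, key2, key2] at e3
    rw [map_sub] at e4
    linarith
  have hΦD : ∀ x, Φ (D x) = -2 * Φ x := by
    intro x
    obtain ⟨f, rfl⟩ := hP x
    rw [hDP, hΦP, hΦP, hΨ]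
  have hD := end_eq e D Φ (-2) hΦD (P f₀) (by rw [hΦP]; exact hf₀)
  have hX := shiftSeq_exact p
  have hepi : Epi (δ hX 2 3 rfl) := epi_δ_of_isZero hX 2 h3
  have hex := mapShortComplex₃_exact hX (i := 2) (j := 3) rfl
  refine coker_zmod e D (δ hX 2 3 rfl).hom.toAddMonoidHom
    ((ModuleCat.epi_iff_surjective _).1 hepi) (fun x => ⟨fun h => ?_, ?_⟩) hD
  · exact (ShortComplex.moduleCat_exact_iff _).1 hex x h
  · rintro ⟨y, rfl⟩
    exact LinearMap.congr_fun (congrArg ModuleCat.Hom.hom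
      (mapShortComplex₃ hX (i := 2) (j := 3) rfl).zero) y

lemma isZero_int (e : G →* Multiplicative ℤ) (he : Function.Bijective e) (n : ℕ) :
    Limits.IsZero (groupCohomology (Rep.trivial ℤ G ℤ) (n + 2)) := by
  have : Subsingleton e.ker := ⟨fun a b => Subtype.ext (he.1 (a.2.trans b.2.symm))⟩
  exact isZero_step e he.2 (n + 1) (isZero_groupCohomology_succ_of_subsingleton _ _)
    (isZero_groupCohomology_succ_of_subsingleton _ _)

lemma isZero_int2 (e : G ≃* Multiplicative (Fin 2 → ℤ)) (n : ℕ) :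
    Limits.IsZero (groupCohomology (Rep.trivial ℤ G ℤ) (n + 3)) := by
  let c (j : Fin 2) : G →* Multiplicative ℤ :=
    (AddMonoidHom.toMultiplicative (Pi.evalAddMonoidHom (fun _ : Fin 2 => ℤ) j)).comp e.toMonoidHom
  have hc : ∀ j g, c j g = .ofAdd ((e g).toAdd j) := fun _ _ => rfl
  have hs : Function.Surjective (c 0) := fun m =>
    ⟨e.symm (.ofAdd ![m.toAdd, 0]), by rw [hc]; simp⟩
  have hb : Function.Bijective ((c 1).comp (c 0).ker.subtype) := by
    constructor
    · intro a b h
      have h1 : c 1 a = c 1 b := h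
      have h0 : c 0 a = c 0 b := a.2.trans b.2.symm
      refine Subtype.ext (e.injective (Multiplicative.toAdd.injective (funext fun j => ?_)))
      fin_cases j
      · exact h0
      · exact h1
    · intro m
      refine ⟨⟨e.symm (.ofAdd ![0, m.toAdd]), ?_⟩, ?_⟩
      · rw [MonoidHom.mem_ker, hc]; simp
      · change c 1 _ = _
        rw [hc]; simp
  exact isZero_step (c 0) hs (n + 2) (isZero_int _ hb n) (isZero_int _ hb (n + 1))

end Main

lemma torusAut_apply (θ : GL (Fin 2) ℤ) (v : Fin 2 → ℤ) :
    torusAut θ (.ofAdd v) = .ofAdd ((θ : Matrix (Fin 2) (Fin 2) ℤ).mulVec v) := by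
  rfl

/-- If `det θ = -1`, then `H³(G, ℤ) ≅ ℤ/2`. -/
theorem torusBundle_H3_detNegOne (θ : GL (Fin 2) ℤ)
    (hdet : (θ : Matrix (Fin 2) (Fin 2) ℤ).det = -1) :
    Nonempty ((groupCohomology (Rep.trivial ℤ (TorusBundleGroup θ) ℤ) 3) ≃+ ZMod 2) := by
  let p : TorusBundleGroup θ →* Multiplicative ℤ :=
    SemidirectProduct.rightHom (φ := torusAction θ)
  let i : Multiplicative (Fin 2 → ℤ) →* TorusBundleGroup θ :=
    SemidirectProduct.inl (φ := torusAction θ)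
  have hp : Function.Surjective p := SemidirectProduct.rightHom_surjective
  have hi : Function.Injective i := SemidirectProduct.inl_injective
  have hr : i.range = p.ker := SemidirectProduct.range_inl_eq_ker_rightHom
  let e : Multiplicative (Fin 2 → ℤ) ≃* p.ker :=
    (MonoidHom.ofInjective hi).trans (MulEquiv.subgroupCongr hr)
  obtain ⟨e2⟩ := h2_iso e
  let t : TorusBundleGroup θ := SemidirectProduct.inr (φ := torusAction θ) (.ofAdd 1)
  have h2 : torusAction θ (.ofAdd 1) = torusAut θ := by
    simp [torusAction]
  -- the function `k ↦ θ^k v`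
  let W (k : ℤ) (v : Multiplicative (Fin 2 → ℤ)) : Fin 2 → ℤ :=
    (torusAction θ (.ofAdd k) v).toAdd
  have hW1 : ∀ k v w, W k (v * w) = W k v + W k w := fun k v w => by
    simp [W]
  have hW2 : ∀ k (m : Multiplicative ℤ) v, W k (torusAction θ m v) = W (k + m.toAdd) v :=
    fun k m v => by simp [W]
  let L (g : TorusBundleGroup θ) : Multiplicative (Fin 2 → ℤ) :=
    SemidirectProduct.left (φ := torusAction θ) g
  have hL : ∀ g h, L (g * h) = L g * torusAction θ (p g) (L h) := fun _ _ => rfl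
  let f₀ : cocycles₂ (shiftRep p) :=
    ⟨fun x k => W k (L x.1) 0 * W (k + (p x.1).toAdd) (L x.2) 1, by
      rw [mem_cocycles₂_iff]
      intro g h j
      refine funext fun k => ?_
      change W k (L (g * h)) 0 * W (k + (p (g * h)).toAdd) (L j) 1 +
        W k (L g) 0 * W (k + (p g).toAdd) (L h) 1 =
        W (k + (p g).toAdd) (L h) 0 * W (k + (p g).toAdd + (p h).toAdd) (L j) 1 +
        W k (L g) 0 * W (k + (p g).toAdd) (L (h * j)) 1
      rw [hL, hL, hW1, hW1, hW2, hW2, map_mul, toAdd_mul, ← add_assoc]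
      simp only [Pi.add_apply]
      ring⟩
  refine h3_of p
    ((shapiroShift p hp 2).toLinearEquiv.toAddEquiv.trans e2)
    ((isZero_int2 e.symm 0).of_iso (shapiroShift p hp 3)) i (fun _ => rfl) t rfl
    (θ : Matrix (Fin 2) (Fin 2) ℤ).mulVec ?_ ?_ f₀ ?_
  · intro v
    have h := SemidirectProduct.inl_aut (φ := torusAction θ) (.ofAdd 1) (.ofAdd v)
    rw [h2, torusAut_apply] at h
    refine (mul_inv_eq_iff_eq_mul (G := SemidirectProduct _ _ (torusAction θ))).1 ?_
    rw [← map_inv]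
    exact h.symm
  · rw [Matrix.det_fin_two] at hdet
    simp [Matrix.mulVec, dotProduct, Fin.sum_univ_two]
    linarith
  · change W 0 (.ofAdd ![1, 0]) 0 * W 0 (.ofAdd ![0, 1]) 1 -
      W 0 (.ofAdd ![0, 1]) 0 * W 0 (.ofAdd ![1, 0]) 1 ≠ 0
    simp [W]
end

section
/- For every n ≥ 4, the group cohomology H^n(G, ℤ) with trivial coefficients vanishes: H^n(G, ℤ) ≅ 0. -/
open CategoryTheory

namespace TorusBundleAux

/-- Every function on `ℤ` is a forward difference. -/
lemma exists_primitive {A : Type} [AddCommGroup A] (H : ℤ → A) :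
    ∃ F : ℤ → A, ∀ n, F (n + 1) - F n = H n := by
  refine ⟨fun n => match n with
    | Int.ofNat m => ∑ i ∈ Finset.range m, H i
    | Int.negSucc m => -∑ i ∈ Finset.range (m + 1), H (-(i + 1 : ℤ)), fun n => ?_⟩
  rcases n with m | m
  · have : (Int.ofNat m + 1) = Int.ofNat (m + 1) := rfl
    rw [this]
    simp [Finset.sum_range_succ]
  · rcases m with _ | m
    · have : (Int.negSucc 0 + 1) = Int.ofNat 0 := rfl
      rw [this]
      simp
    · have : (Int.negSucc (m + 1) + 1) = Int.negSucc m := by omega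
      rw [this]
      simp only [Finset.sum_range_succ _ (m + 1)]
      have h2 : Int.negSucc (m + 1) = -(((m + 1 : ℕ) : ℤ) + 1) := by omega
      rw [h2]
      abel

variable {k : Type} [CommRing k] {G : Type} [Group G] (p : G →* Multiplicative ℤ) (A : Rep.{0} k G)

/-- The coinduced representation from the kernel of `p`. -/
noncomputable abbrev K : Rep.{0} k G :=
  Rep.coind p.ker.subtype (Rep.res p.ker.subtype A)

lemma K_prop (f : Representation.coindV p.ker.subtype (Rep.res p.ker.subtype A).ρ) (s : G) (hs : p s = 1) (x : G) :
    f.1 (s * x) = A.ρ s (f.1 x) := f.2 ⟨s, hs⟩ x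

/-- The unit `A → Coind Res A`. -/
noncomputable def unit : A ⟶ K p A := Rep.ofHom
  { toFun := fun a => ⟨fun x => A.ρ x a, fun g h => by simp⟩
    map_add' := fun a b => by ext; simp
    map_smul' := fun a b => by ext; simp
    isIntertwining' := fun g => LinearMap.ext fun a => Subtype.ext <| funext fun x => by
      change A.ρ x (A.ρ g a) = A.ρ (x * g) a
      simp }

/-- The difference operator `f ↦ (x ↦ t⁻¹ f (t x) - f x)`. -/
noncomputable def diff (t : G) : K p A ⟶ K p A := Rep.ofHom
  { toFun := fun f => ⟨fun x => A.ρ t⁻¹ (f.1 (t * x)) - f.1 x, fun g h => by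
      have h1 : t * ((g : G) * h) = (t * g * t⁻¹) * (t * h) := by group
      have h2 : p g = 1 := g.2
      have h3 := K_prop p A f (t * g * t⁻¹) (by simp [h2]) (t * h)
      have h4 := K_prop p A f g h2 h
      simp only [Subgroup.subtype_apply]
      rw [h1, h3, h4]
      simp [← Module.End.mul_apply, ← map_mul, mul_assoc]⟩
    map_add' := fun a b => by ext; simp; abel
    map_smul' := fun a b => by ext; simp [smul_sub]
    isIntertwining' := fun g => LinearMap.ext fun f => Subtype.ext <| funext fun x => by
      change A.ρ t⁻¹ (f.1 (t * x * g)) - f.1 (x * g) = A.ρ t⁻¹ (f.1 (t * (x * g))) - f.1 (x * g)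
      rw [mul_assoc] }

lemma unit_apply (a : A) (x : G) : ((unit p A).hom a).1 x = A.ρ x a := rfl

lemma diff_apply (t : G) (f : K p A) (x : G) :
    ((diff p A t).hom f).1 x = A.ρ t⁻¹ (f.1 (t * x)) - f.1 x := rfl

lemma unit_diff (t : G) : unit p A ≫ diff p A t = 0 := by
  refine Rep.hom_ext (Representation.IntertwiningMap.ext (LinearMap.ext fun a => ?_))
  refine Subtype.ext (funext fun x => ?_)
  change A.ρ t⁻¹ (A.ρ (t * x) a) - A.ρ x a = 0
  simp

lemma decomp {t : G} (ht : p t = Multiplicative.ofAdd 1) (x : G) :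
    p (x * (t ^ (p x).toAdd)⁻¹) = 1 := by
  rw [map_mul, map_inv, map_zpow, ht, ← ofAdd_zsmul]
  simp

lemma ker_eq {t : G} (ht : p t = Multiplicative.ofAdd 1) (f : K p A)
    (hf : (diff p A t).hom f = 0) : (unit p A).hom (f.1 1) = f := by
  have h1 : ∀ x, f.1 (t * x) = A.ρ t (f.1 x) := fun x => by
    have h := congrFun (congrArg Subtype.val hf) x
    have hh : A.ρ t⁻¹ (f.1 (t * x)) - f.1 x = 0 := h
    rw [← sub_eq_zero.1 hh]
    simp
  have h2 : ∀ n : ℤ, f.1 (t ^ n) = A.ρ (t ^ n) (f.1 1) := fun n => by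
    induction n using Int.induction_on with
    | zero => simp
    | succ i ih =>
      rw [add_comm, zpow_add, zpow_one, h1, ih]
      simp
    | pred i ih =>
      have h := h1 (t ^ (-(i : ℤ) - 1))
      have e : t * t ^ (-(i : ℤ) - 1) = t ^ (-(i : ℤ)) := by
        rw [← zpow_one_add]; congr 1; ring
      rw [e, ih] at h
      have hh := congrArg (A.ρ t⁻¹) h
      rw [← e] at hh
      simpa using hh.symm
  refine Subtype.ext (funext fun x => ?_)
  rw [unit_apply]
  have h3 := K_prop p A f _ (decomp p ht x) (t ^ (p x).toAdd)
  rw [h2] at h3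
  simpa [← Module.End.mul_apply, ← map_mul] using h3.symm

lemma diff_surj {t : G} (ht : p t = Multiplicative.ofAdd 1) :
    Function.Surjective (diff p A t).hom := by
  intro g
  obtain ⟨F, hF⟩ := exists_primitive (fun n : ℤ => A.ρ (t ^ n)⁻¹ (g.1 (t ^ n)))
  refine ⟨⟨fun x => A.ρ x (F (p x).toAdd), fun s x => ?_⟩, Subtype.ext (funext fun x => ?_)⟩
  · have : p s = 1 := s.2
    simp [this]
  · rw [diff_apply]
    have h3 := K_prop p A g _ (decomp p ht x) (t ^ (p x).toAdd)
    have h4 := hF (p x).toAdd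
    have e : (p (t * x)).toAdd = (p x).toAdd + 1 := by
      rw [map_mul, ht, toAdd_mul, toAdd_ofAdd, add_comm]
    simp only [e]
    rw [inv_mul_cancel_right] at h3
    rw [h3, map_mul A.ρ t x, Module.End.mul_apply, Representation.inv_self_apply, ← map_sub, h4,
      map_mul, Module.End.mul_apply]

lemma unit_inj : Function.Injective (unit p A).hom := by
  intro a b h
  have h := congrFun (congrArg Subtype.val h) 1
  have hh : A.ρ 1 a = A.ρ 1 b := h
  simpa using hh

/-- The short complex `A → Coind Res A → Coind Res A`. -/
noncomputable abbrev sc (t : G) : ShortComplex (Rep.{0} k G) :=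
  ShortComplex.mk _ _ (unit_diff p A t)

lemma sc_shortExact {t : G} (ht : p t = Multiplicative.ofAdd 1) : (sc p A t).ShortExact where
  exact := by
    rw [← ShortComplex.exact_map_iff_of_faithful _ (forget₂ (Rep.{0} k G) (ModuleCat k)),
      ShortComplex.moduleCat_exact_iff]
    intro f hf
    exact ⟨f.1 1, ker_eq p A ht f hf⟩
  mono_f := (Rep.mono_iff_injective _).2 (unit_inj p A)
  epi_g := (Rep.epi_iff_surjective _).2 (diff_surj p A ht)

/-- Cohomological dimension (over `ℤ`) at most `d`. -/
def CdLE (G : Type) [Group G] (d : ℕ) : Prop :=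
  ∀ (A : Rep.{0} ℤ G) (n : ℕ), d < n → Limits.IsZero (groupCohomology A n)

lemma cdLE_succ {d : ℕ} (t : G) (ht : p t = Multiplicative.ofAdd 1) (h : CdLE p.ker d) :
    CdLE G (d + 1) := by
  intro A n hn
  obtain ⟨m, rfl⟩ : ∃ m, n = m + 1 := ⟨n - 1, by omega⟩
  have hz : ∀ i, d < i → Limits.IsZero (groupCohomology (K p A) i) := fun i hi =>
    (h (Rep.res p.ker.subtype A) i hi).of_iso (groupCohomology.coindIso _ i)
  have h1 := groupCohomology.mapShortComplex₁_exact (sc_shortExact p A ht) (i := m) rfl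
  exact h1.isZero_of_both_zeros ((hz m (by omega)).eq_of_src _ _) ((hz (m + 1) (by omega)).eq_of_tgt _ _)

lemma cdLE_zero [Subsingleton G] : CdLE G 0 := by
  intro A n hn
  obtain ⟨m, rfl⟩ : ∃ m, n = m + 1 := ⟨n - 1, by omega⟩
  exact isZero_groupCohomology_succ_of_subsingleton A m

/-- `G → ℤ`. -/
noncomputable def p1 (θ : GL (Fin 2) ℤ) : TorusBundleGroup θ →* Multiplicative ℤ :=
  SemidirectProduct.rightHom

/-- Coordinate on the kernel of `p1`. -/
noncomputable def coord (θ : GL (Fin 2) ℤ) (i : Fin 2) : (p1 θ).ker →* Multiplicative ℤ where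
  toFun x := Multiplicative.ofAdd ((SemidirectProduct.left x.1).toAdd i)
  map_one' := rfl
  map_mul' x y := by
    have hx : SemidirectProduct.right x.1 = 1 := x.2
    have : SemidirectProduct.left (x * y).1 = 
        SemidirectProduct.left x.1 * SemidirectProduct.left y.1 := by
      refine (SemidirectProduct.mul_left _ _).trans ?_
      rw [hx]; simp
    rw [this]; rfl

/-- Elements of `ℤ²` inside the kernel of `p1`. -/
noncomputable def inj (θ : GL (Fin 2) ℤ) (v : Fin 2 → ℤ) : (p1 θ).ker :=
  ⟨(⟨Multiplicative.ofAdd v, 1⟩ : SemidirectProduct _ _ (torusAction θ)), rfl⟩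

/-- Second coordinate on the kernel of the first one. -/
noncomputable def p3 (θ : GL (Fin 2) ℤ) : (coord θ 0).ker →* Multiplicative ℤ :=
  (coord θ 1).comp (coord θ 0).ker.subtype

instance (θ : GL (Fin 2) ℤ) : Subsingleton (p3 θ).ker := by
  refine subsingleton_of_forall_eq 1 fun x => ?_
  have h1 : coord θ 1 x.1.1 = 1 := x.2
  have h0 : coord θ 0 x.1.1 = 1 := x.1.2
  have hr : SemidirectProduct.right x.1.1.1 = 1 := x.1.1.2
  refine Subtype.ext (Subtype.ext (Subtype.ext (SemidirectProduct.ext ?_ hr)))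
  refine Multiplicative.toAdd.injective (funext fun i => ?_)
  fin_cases i
  · exact h0
  · exact h1

lemma cdLE_three (θ : GL (Fin 2) ℤ) : CdLE (TorusBundleGroup θ) 3 := by
  refine cdLE_succ (p1 θ) (⟨1, Multiplicative.ofAdd 1⟩ : SemidirectProduct _ _ (torusAction θ)) rfl ?_
  refine cdLE_succ (coord θ 0) (inj θ ![1, 0]) rfl ?_
  exact cdLE_succ (p3 θ) ⟨inj θ ![0, 1], rfl⟩ rfl cdLE_zero

end TorusBundleAux

/-- `H^n(G, ℤ) = 0` for all `n ≥ 4`. -/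
theorem torusBundle_Hn_int_vanishes (θ : GL (Fin 2) ℤ) (n : ℕ) (hn : 4 ≤ n) :
    Subsingleton (groupCohomology (Rep.trivial ℤ (TorusBundleGroup θ) ℤ) n) :=
  ModuleCat.subsingleton_of_isZero (TorusBundleAux.cdLE_three θ _ n (by omega))
end

section
/- H²(G, 𝔽₂) ≅ (𝔽₂)^{3 − r₂}, where r₂ is the rank over the field 𝔽₂ of the reduction modulo 2 of the integer matrix θ − I. -/
namespace TorusH2

/-- Integer-indexed partial sums. -/
def sumZ (g : ℤ → ZMod 2) : ℤ → ZMod 2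
  | Int.ofNat n => ∑ i ∈ Finset.range n, g i
  | Int.negSucc n => -∑ i ∈ Finset.range (n + 1), g (-((i : ℤ) + 1))

theorem sumZ_zero (g : ℤ → ZMod 2) : sumZ g 0 = 0 := by
  change sumZ g (Int.ofNat 0) = 0
  simp [sumZ]

theorem sumZ_succ (g : ℤ → ZMod 2) (k : ℤ) : sumZ g (k + 1) = sumZ g k + g k := by
  rcases k with n | n
  · change sumZ g (Int.ofNat (n + 1)) = _
    simp [sumZ, Finset.sum_range_succ]
  · rcases n with _ | n
    · change sumZ g (Int.ofNat 0) = -∑ i ∈ Finset.range 1, g (-((i : ℤ) + 1)) + g (-1)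
      rw [Finset.sum_range_one]
      change 0 = -g (-1) + g (-1)
      ring
    · have : Int.negSucc (n + 1) + 1 = Int.negSucc n := by omega
      rw [this]
      have h2 : Int.negSucc (n + 1) = -(((n + 1 : ℕ) : ℤ) + 1) := by omega
      simp only [sumZ]
      rw [Finset.sum_range_succ _ (n + 1), h2]
      ring

theorem sumZ_add (g g' : ℤ → ZMod 2) (k : ℤ) : sumZ (g + g') k = sumZ g k + sumZ g' k := by
  rcases k with n | n <;> simp [sumZ, Finset.sum_add_distrib] <;> ring

theorem sumZ_smul (c : ZMod 2) (g : ℤ → ZMod 2) (k : ℤ) : sumZ (c • g) k = c * sumZ g k := by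
  rcases k with n | n <;> simp [sumZ, Finset.mul_sum]

/-- Two-cocycles with trivial coefficients `𝔽₂`. -/
def Z (G : Type) [Group G] : Submodule (ZMod 2) (G × G → ZMod 2) where
  carrier := {f | ∀ g h j : G, f (g * h, j) + f (g, h) = f (h, j) + f (g, h * j)}
  zero_mem' := by intro g h j; simp
  add_mem' := by
    intro f f' hf hf' g h j
    simp only [Pi.add_apply]
    linear_combination hf g h j + hf' g h j
  smul_mem' := by
    intro c f hf g h j
    simp only [Pi.smul_apply, smul_eq_mul]
    linear_combination c * hf g h j

section ext
variable {G : Type} [Group G]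

/-- The central extension attached to a cocycle. -/
@[ext] structure Ext (f : Z G) where
  u : ZMod 2
  x : G

variable (f : Z G)

theorem Z.one_left (g : G) : f.1 (1, g) = f.1 (1, 1) := by
  have := f.2 1 1 g
  simp only [one_mul] at this
  linear_combination -this

theorem Z.one_right (g : G) : f.1 (g, 1) = f.1 (1, 1) := by
  have := f.2 g 1 1
  simp only [mul_one] at this
  linear_combination this

instance : Mul (Ext f) := ⟨fun a b => ⟨a.u + b.u + f.1 (a.x, b.x), a.x * b.x⟩⟩
instance : One (Ext f) := ⟨⟨-f.1 (1, 1), 1⟩⟩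
instance : Inv (Ext f) := ⟨fun a => ⟨-a.u - f.1 (1, 1) - f.1 (a.x⁻¹, a.x), a.x⁻¹⟩⟩

@[simp] theorem Ext.mul_u (a b : Ext f) : (a * b).u = a.u + b.u + f.1 (a.x, b.x) := rfl
@[simp] theorem Ext.mul_x (a b : Ext f) : (a * b).x = a.x * b.x := rfl
@[simp] theorem Ext.one_u : (1 : Ext f).u = -f.1 (1, 1) := rfl
@[simp] theorem Ext.one_x : (1 : Ext f).x = 1 := rfl
@[simp] theorem Ext.inv_u (a : Ext f) : (a⁻¹).u = -a.u - f.1 (1, 1) - f.1 (a.x⁻¹, a.x) := rfl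
@[simp] theorem Ext.inv_x (a : Ext f) : (a⁻¹).x = a.x⁻¹ := rfl

instance : Group (Ext f) := Group.ofLeftAxioms
  (by
    intro a b c
    ext
    · simp only [Ext.mul_u, Ext.mul_x]
      linear_combination f.2 a.x b.x c.x
    · simp [mul_assoc])
  (by
    intro a
    ext
    · simp only [Ext.mul_u, Ext.one_u, Ext.one_x, Z.one_left f a.x]
      ring
    · simp)
  (by
    intro a
    ext
    · simp only [Ext.mul_u, Ext.one_u, Ext.inv_u, Ext.inv_x]
      ring
    · simp)

/-- Projection to the base. -/
def Ext.proj : Ext f →* G where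
  toFun := Ext.x
  map_one' := rfl
  map_mul' _ _ := rfl

/-- The central component of powers. -/
def pw (f : G × G → ZMod 2) (x : G) (k : ℤ) : ZMod 2 :=
  -f (1, 1) + sumZ (fun i => f (x ^ i, x)) k

theorem pw_zero (f : G × G → ZMod 2) (x : G) : pw f x 0 = -f (1, 1) := by
  simp [pw, sumZ_zero]

theorem pw_succ (f : G × G → ZMod 2) (x : G) (k : ℤ) :
    pw f x (k + 1) = pw f x k + f (x ^ k, x) := by
  simp [pw, sumZ_succ]; ring

theorem pw_add (f f' : G × G → ZMod 2) (x : G) (k : ℤ) :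
    pw (f + f') x k = pw f x k + pw f' x k := by
  have := sumZ_add (fun i => f (x ^ i, x)) (fun i => f' (x ^ i, x)) k
  simp only [pw, Pi.add_apply]
  change _ + sumZ ((fun i : ℤ => f (x ^ i, x)) + (fun i : ℤ => f' (x ^ i, x))) k = _
  rw [this]; ring

theorem pw_smul (c : ZMod 2) (f : G × G → ZMod 2) (x : G) (k : ℤ) :
    pw (c • f) x k = c * pw f x k := by
  have := sumZ_smul c (fun i => f (x ^ i, x)) k
  simp only [pw, Pi.smul_apply, smul_eq_mul]
  change _ + sumZ (c • (fun i : ℤ => f (x ^ i, x))) k = _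
  rw [this]; ring

theorem zpow_eq (x : G) (k : ℤ) : (⟨0, x⟩ : Ext f) ^ k = ⟨pw f.1 x k, x ^ k⟩ := by
  have step : ∀ k : ℤ, (⟨pw f.1 x (k + 1), x ^ (k + 1)⟩ : Ext f)
      = ⟨pw f.1 x k, x ^ k⟩ * ⟨0, x⟩ := by
    intro k
    ext
    · simp [pw_succ]
    · simp [zpow_add]
  induction k using Int.induction_on with
  | zero => ext <;> simp [pw_zero]
  | succ i ih => rw [zpow_add, ih, zpow_one, step]
  | pred i ih =>
    have := step (-(i : ℤ) - 1)
    rw [sub_add_cancel, ← ih] at this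
    rw [zpow_sub, zpow_one, this, mul_inv_cancel_right]

/-- Coboundary. -/
def cob (h : G → ZMod 2) : Z G :=
  ⟨fun p => h p.2 - h (p.1 * p.2) + h p.1, by
    intro a b c
    simp only [mul_assoc]
    ring⟩

/-- Splitting of a coboundary extension. -/
def chi (h : G → ZMod 2) : Ext (cob h) →* Multiplicative (ZMod 2) where
  toFun e := Multiplicative.ofAdd (e.u + h e.x)
  map_one' := by
    have : (cob h).1 (1, 1) = h 1 := by simp [cob]
    rw [Ext.one_u, Ext.one_x, this, neg_add_cancel, ofAdd_zero]
  map_mul' a b := by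
    rw [← ofAdd_add]
    congr 1
    have : (cob h).1 (a.x, b.x) = h b.x - h (a.x * b.x) + h a.x := rfl
    rw [Ext.mul_u, Ext.mul_x, this]
    ring

/-- Defect of the relation `t x = a^m b^n t` -/
def defect (a b t x : G) (m n : ℤ) (f : G × G → ZMod 2) : ZMod 2 :=
  f (t, x) - (pw f a m + pw f b n + f (a ^ m, b ^ n) + f (a ^ m * b ^ n, t))

theorem defect_spec (a b t x : G) (m n : ℤ) (hx : t * x = a ^ m * b ^ n * t) :
    (⟨0, t⟩ : Ext f) * ⟨0, x⟩ = ⟨-f.1 (1, 1) + defect a b t x m n f.1, 1⟩ *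
      ((⟨0, a⟩ : Ext f) ^ m * ⟨0, b⟩ ^ n * ⟨0, t⟩) := by
  ext
  · simp only [Ext.mul_u, Ext.mul_x, zpow_eq, defect, Z.one_left]
    ring
  · simp [zpow_eq, hx]

theorem defect_cob (a b t x : G) (m n : ℤ) (hx : t * x = a ^ m * b ^ n * t) (h : G → ZMod 2) :
    defect a b t x m n (cob h).1 = h x - m * h a - n * h b := by
  have h1 := congrArg (fun e => (chi h e).toAdd) (defect_spec (cob h) a b t x m n hx)
  simp only [map_mul, map_zpow, toAdd_mul, toAdd_zpow] at h1
  have h0 : (cob h).1 (1, 1) = h 1 := by simp [cob]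
  simp only [chi, MonoidHom.coe_mk, OneHom.coe_mk, toAdd_ofAdd, h0, zsmul_eq_mul] at h1
  linear_combination -h1

end ext


section torus

variable (θ : GL (Fin 2) ℤ)

/-- The group. -/
abbrev GG : Type :=
  SemidirectProduct (Multiplicative (Fin 2 → ℤ)) (Multiplicative ℤ) (torusAction θ)

/-- Generators of the fibre. -/
def e (i : Fin 2) : Multiplicative (Fin 2 → ℤ) := Multiplicative.ofAdd (Pi.single i 1)

/-- Generators of the fibre in the group. -/
noncomputable def ga (i : Fin 2) : GG θ := SemidirectProduct.inl (e i)

/-- The stable letter. -/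
noncomputable def gt : GG θ := SemidirectProduct.inr (Multiplicative.ofAdd 1)

theorem n_eq (n : Multiplicative (Fin 2 → ℤ)) :
    n = e 0 ^ (n.toAdd 0) * e 1 ^ (n.toAdd 1) := by
  apply Multiplicative.toAdd.injective
  funext i
  fin_cases i <;> simp [e]

theorem torusAut_apply (n : Multiplicative (Fin 2 → ℤ)) (i : Fin 2) :
    (torusAut θ n).toAdd i = θ.1 i 0 * n.toAdd 0 + θ.1 i 1 * n.toAdd 1 := by
  change (Matrix.mulVec θ.1 n.toAdd) i = _
  simp [Matrix.mulVec, dotProduct, Fin.sum_univ_two]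

theorem torusAction_one : torusAction θ (Multiplicative.ofAdd 1) = torusAut θ := by
  simp [torusAction]

theorem torusAut_e (i : Fin 2) : torusAut θ (e i) = e 0 ^ (θ.1 0 i) * e 1 ^ (θ.1 1 i) := by
  rw [n_eq (torusAut θ (e i)), torusAut_apply, torusAut_apply]
  fin_cases i <;> simp [e]

theorem rel_a : ga θ 0 * ga θ 1 = ga θ 1 * ga θ 0 := by
  simp only [ga, ← map_mul, mul_comm]

theorem rel_t (i : Fin 2) : gt θ * ga θ i = ga θ 0 ^ (θ.1 0 i) * ga θ 1 ^ (θ.1 1 i) * gt θ := by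
  have h := SemidirectProduct.inl_aut (φ := torusAction θ) (Multiplicative.ofAdd 1) (e i)
  rw [torusAction_one, torusAut_e, map_mul, map_zpow, map_zpow, map_inv] at h
  simp only [ga, gt]
  rw [h, inv_mul_cancel_right]

/-- Evaluation on the three relators. -/
noncomputable def ev : Z (GG θ) →ₗ[ZMod 2] ZMod 2 × (Fin 2 → ZMod 2) where
  toFun f := (f.1 (ga θ 0, ga θ 1) - f.1 (ga θ 1, ga θ 0),
    fun i => defect (ga θ 0) (ga θ 1) (gt θ) (ga θ i) (θ.1 0 i) (θ.1 1 i) f.1)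
  map_add' f g := by
    ext
    · simp only [Submodule.coe_add, Pi.add_apply, Prod.fst_add]; ring
    · simp only [Submodule.coe_add, Pi.add_apply, Prod.snd_add, defect, pw_add]; ring
  map_smul' c f := by
    ext
    · simp only [Submodule.coe_smul, Pi.smul_apply, Prod.smul_fst, smul_eq_mul, RingHom.id_apply]
      ring
    · simp only [Submodule.coe_smul, Pi.smul_apply, Prod.smul_snd, smul_eq_mul, RingHom.id_apply,
        defect, pw_smul]
      ring

/-- The matrix `θ - 1` mod 2. -/
abbrev MM : Matrix (Fin 2) (Fin 2) (ZMod 2) :=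
  ((θ : Matrix (Fin 2) (Fin 2) ℤ) - 1).map (Int.cast : ℤ → ZMod 2)

/-- The coboundary on relators. -/
noncomputable def DD : (Fin 2 → ZMod 2) →ₗ[ZMod 2] ZMod 2 × (Fin 2 → ZMod 2) :=
  LinearMap.inr (ZMod 2) (ZMod 2) (Fin 2 → ZMod 2) ∘ₗ (MM θ).transpose.mulVecLin

theorem ev_cob (h : GG θ → ZMod 2) : ev θ (cob h) = DD θ (fun i => -h (ga θ i)) := by
  ext i
  · simp only [ev, DD, LinearMap.coe_mk, AddHom.coe_mk, cob, rel_a]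
    simp
    ring
  · simp only [ev, LinearMap.coe_mk, AddHom.coe_mk, defect_cob _ _ _ _ _ _ (rel_t θ i)]
    simp only [DD, LinearMap.comp_apply, LinearMap.inr_apply, Matrix.mulVecLin_apply,
      Matrix.mulVec, dotProduct, Fin.sum_univ_two, Matrix.transpose_apply, Matrix.map_apply,
      Matrix.sub_apply, Int.cast_sub]
    revert i
    rw [Fin.forall_fin_two]
    have h01 : (1 : Matrix (Fin 2) (Fin 2) ℤ) 0 1 = 0 := rfl
    have h10 : (1 : Matrix (Fin 2) (Fin 2) ℤ) 1 0 = 0 := rfl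
    simp only [Matrix.one_apply_eq, h01, h10, Int.cast_one, Int.cast_zero]
    constructor <;> ring

theorem ga_inj : ga θ 0 ≠ ga θ 1 := by
  intro h
  have h2 := SemidirectProduct.inl_injective h
  have h3 := congrFun (congrArg Multiplicative.toAdd h2) 0
  simp [e] at h3

theorem cob_of_ev_zero (f : Z (GG θ)) (hf : ev θ f = 0) : ∃ h, f = cob h := by
  have h1 : f.1 (ga θ 0, ga θ 1) = f.1 (ga θ 1, ga θ 0) := sub_eq_zero.1 (congrArg Prod.fst hf)
  have h2 : ∀ i, defect (ga θ 0) (ga θ 1) (gt θ) (ga θ i) (θ.1 0 i) (θ.1 1 i) f.1 = 0 :=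
    fun i => congrFun (congrArg Prod.snd hf) i
  let a : Fin 2 → Ext f := fun i => ⟨0, ga θ i⟩
  let t : Ext f := ⟨0, gt θ⟩
  have hab : Commute (a 0) (a 1) := by
    change a 0 * a 1 = a 1 * a 0
    apply Ext.ext
    · simp [a, h1]
    · exact rel_a θ
  have hta : ∀ i, t * a i = a 0 ^ (θ.1 0 i) * a 1 ^ (θ.1 1 i) * t := by
    intro i
    have := defect_spec f _ _ _ _ _ _ (rel_t θ i)
    rw [h2 i, add_zero] at this
    exact this.trans (one_mul (_ : Ext f))
  let fn : Multiplicative (Fin 2 → ℤ) →* Ext f :=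
    { toFun := fun n => a 0 ^ (n.toAdd 0) * a 1 ^ (n.toAdd 1)
      map_one' := by simp
      map_mul' := by
        intro n m
        simp only [toAdd_mul, Pi.add_apply, zpow_add]
        have := (hab.zpow_zpow (m.toAdd 0) (n.toAdd 1)).eq
        simp only [mul_assoc]
        congr 1
        simp only [← mul_assoc]
        rw [this] }
  have fn_e : ∀ i, fn (e i) = a i := by
    intro i
    fin_cases i <;> simp [fn, e]
  have hone : ∀ n, fn (torusAut θ n) = t * fn n * t⁻¹ := by
    have : fn.comp (torusAut θ).toMonoidHom = (MulAut.conj t).toMonoidHom.comp fn := by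
      have key : ∀ i, fn (torusAut θ (e i)) = t * a i * t⁻¹ := by
        intro i
        rw [torusAut_e, map_mul, map_zpow, map_zpow, fn_e, fn_e, hta, mul_inv_cancel_right]
      refine MonoidHom.ext fun n => ?_
      rw [n_eq n]
      simp only [map_mul, map_zpow]
      simp [key, fn_e]
    intro n
    exact DFunLike.congr_fun this n
  have hall : ∀ (k : ℤ) n, fn ((torusAut θ ^ k) n) = t ^ k * fn n * (t ^ k)⁻¹ := by
    intro k
    induction k using Int.induction_on with
    | zero => intro n; simp
    | succ i ih =>
      intro n
      rw [zpow_add, zpow_one, MulAut.mul_apply, ih, hone, zpow_add]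
      group
    | pred i ih =>
      intro n
      have h3 := hone ((torusAut θ)⁻¹ n)
      rw [MulAut.apply_inv_self] at h3
      have h4 : fn ((torusAut θ)⁻¹ n) = t⁻¹ * fn n * t := by rw [h3]; group
      rw [zpow_sub, zpow_one, MulAut.mul_apply, ih, h4, zpow_sub]
      group
  let F : GG θ →* Ext f := SemidirectProduct.lift fn (zpowersHom _ t) (by
    intro k
    refine MonoidHom.ext fun n => ?_
    have h6 := hall k.toAdd n
    rw [← MulAut.conj_apply] at h6
    simpa [torusAction] using h6)
  have hF : ∀ g, (F g).x = g := by
    have : (Ext.proj f).comp F = MonoidHom.id _ := by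
      apply SemidirectProduct.hom_ext
      · refine MonoidHom.ext fun n => ?_
        have : F (SemidirectProduct.inl n) = fn n := SemidirectProduct.lift_inl _ _ _ _
        simp only [MonoidHom.comp_apply, this, MonoidHom.id_apply]
        conv_rhs => rw [n_eq n]
        simp only [fn, MonoidHom.coe_mk, OneHom.coe_mk, map_mul, map_zpow]
        rfl
      · apply MonoidHom.ext_mint
        have : F (SemidirectProduct.inr (Multiplicative.ofAdd 1)) = t := by
          refine (SemidirectProduct.lift_inr _ _ _ _).trans ?_
          simp
        simp only [MonoidHom.comp_apply, this, MonoidHom.id_apply]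
        rfl
    intro g
    exact DFunLike.congr_fun this g
  refine ⟨fun g => -(F g).u, ?_⟩
  apply Subtype.ext
  funext p
  have h5 := congrArg Ext.u (map_mul F p.1 p.2)
  rw [Ext.mul_u, hF, hF] at h5
  simp only [cob]
  rw [h5]
  ring

theorem ev_mem_iff (f : Z (GG θ)) : ev θ f ∈ LinearMap.range (DD θ) ↔ ∃ h, f = cob h := by
  constructor
  · rintro ⟨v, hv⟩
    classical
    let h0 : GG θ → ZMod 2 := fun g => if g = ga θ 0 then -v 0 else -v 1
    have h1 : ev θ (f - cob h0) = 0 := by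
      rw [map_sub, ev_cob, ← hv, sub_eq_zero]
      congr 1
      funext i
      fin_cases i
      · simp [h0]
      · simp [h0, (ga_inj θ).symm]
    obtain ⟨h, hh⟩ := cob_of_ev_zero θ _ h1
    refine ⟨h + h0, ?_⟩
    rw [sub_eq_iff_eq_add.1 hh]
    apply Subtype.ext
    funext p
    simp only [cob, Submodule.coe_add, Pi.add_apply]
    ring
  · rintro ⟨h, rfl⟩
    rw [ev_cob]
    exact ⟨_, rfl⟩

end torus


section surj

variable (θ : GL (Fin 2) ℤ)

/-- The bilinear form. -/
def BB (n m : Multiplicative (Fin 2 → ℤ)) : ZMod 2 := (n.toAdd 0 : ZMod 2) * (m.toAdd 1 : ZMod 2)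

/-- Triangular numbers mod 2. -/
def tri (n : ℤ) : ZMod 2 := ((n * (n - 1) / 2 : ℤ) : ZMod 2)

theorem tri_add (n m : ℤ) : tri (n + m) = tri n + tri m + n * m := by
  have h : ∀ k : ℤ, 2 ∣ k * (k - 1) := fun k => (Int.even_mul_pred_self k).two_dvd
  obtain ⟨x, hx⟩ := h n
  obtain ⟨y, hy⟩ := h m
  have hxy : (n + m) * (n + m - 1) = 2 * (x + y + n * m) := by linear_combination hx + hy
  simp only [tri, hx, hy, hxy]
  simp

/-- The quadratic function. -/
def qq (ε : ZMod 2) (φ : Fin 2 → ZMod 2) (n : Multiplicative (Fin 2 → ℤ)) : ZMod 2 :=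
  ε * (θ.1 0 0 * θ.1 1 0 * tri (n.toAdd 0) + θ.1 0 1 * θ.1 1 1 * tri (n.toAdd 1)
    + θ.1 0 1 * θ.1 1 0 * n.toAdd 0 * n.toAdd 1) + φ 0 * n.toAdd 0 + φ 1 * n.toAdd 1

theorem det_mod : (θ.1 0 0 * θ.1 1 1 + θ.1 0 1 * θ.1 1 0 : ZMod 2) = 1 := by
  have h : IsUnit (θ.1.det) := (Matrix.isUnit_iff_isUnit_det _).1 θ.isUnit
  rw [Matrix.det_fin_two] at h
  have h2 := h.map (Int.castRingHom (ZMod 2))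
  have h3 : ∀ x : ZMod 2, IsUnit x → x = 1 := by
    intro x hx
    have h0 : x ≠ 0 := hx.ne_zero
    revert x
    decide
  have h4 := h3 _ h2
  simp only [eq_intCast, Int.cast_sub, Int.cast_mul] at h4
  rw [CharTwo.sub_eq_add] at h4
  exact h4

theorem qq_mul (ε : ZMod 2) (φ : Fin 2 → ZMod 2) (n m : Multiplicative (Fin 2 → ℤ)) :
    qq θ ε φ (n * m) = qq θ ε φ n + qq θ ε φ m
      + ε * (BB (torusAut θ n) (torusAut θ m) - BB n m) := by
  simp only [qq, BB, torusAut_apply, toAdd_mul, Pi.add_apply, tri_add]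
  push_cast
  have h2 : (2 : ZMod 2) = 0 := rfl
  linear_combination (-ε * n.toAdd 0 * m.toAdd 1) * det_mod θ
    + (ε * n.toAdd 0 * m.toAdd 1 * (θ.1 0 1 * θ.1 1 0)) * h2

/-- Iterates of the quadratic function. -/
noncomputable def qs (ε : ZMod 2) (φ : Fin 2 → ZMod 2) (s : ℤ)
    (n : Multiplicative (Fin 2 → ℤ)) : ZMod 2 :=
  sumZ (fun i => qq θ ε φ ((torusAut θ ^ i) n)) s

theorem int_ind {P : ℤ → Prop} (h0 : P 0) (h : ∀ k, P k ↔ P (k + 1)) (k : ℤ) : P k := by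
  induction k using Int.induction_on with
  | zero => exact h0
  | succ i ih => exact (h _).1 ih
  | pred i ih => exact (h _).2 (by simpa using ih)

theorem qs_succ (ε : ZMod 2) (φ : Fin 2 → ZMod 2) (s : ℤ) (n : Multiplicative (Fin 2 → ℤ)) :
    qs θ ε φ (s + 1) n = qs θ ε φ s n + qq θ ε φ ((torusAut θ ^ s) n) := sumZ_succ _ _

theorem qs_zero (ε : ZMod 2) (φ : Fin 2 → ZMod 2) (n : Multiplicative (Fin 2 → ℤ)) :
    qs θ ε φ 0 n = 0 := sumZ_zero _

theorem aut_succ (s : ℤ) (n : Multiplicative (Fin 2 → ℤ)) :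
    (torusAut θ ^ (s + 1)) n = torusAut θ ((torusAut θ ^ s) n) := by
  rw [add_comm, zpow_add, zpow_one, MulAut.mul_apply]

theorem aut_add (s s' : ℤ) (n : Multiplicative (Fin 2 → ℤ)) :
    (torusAut θ ^ (s + s')) n = (torusAut θ ^ s) ((torusAut θ ^ s') n) := by
  rw [zpow_add, MulAut.mul_apply]

theorem qs_mul (ε : ZMod 2) (φ : Fin 2 → ZMod 2) (s : ℤ) (n m : Multiplicative (Fin 2 → ℤ)) :
    qs θ ε φ s (n * m) = qs θ ε φ s n + qs θ ε φ s m
      + ε * (BB ((torusAut θ ^ s) n) ((torusAut θ ^ s) m) - BB n m) := by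
  induction s using int_ind with
  | h0 => simp [qs_zero]
  | h s =>
    simp only [qs_succ, map_mul, qq_mul, aut_succ]
    constructor <;> intro h <;> linear_combination h

theorem qs_add (ε : ZMod 2) (φ : Fin 2 → ZMod 2) (s s' : ℤ) (n : Multiplicative (Fin 2 → ℤ)) :
    qs θ ε φ (s + s') n = qs θ ε φ s ((torusAut θ ^ s') n) + qs θ ε φ s' n := by
  induction s using int_ind with
  | h0 => simp [qs_zero]
  | h s =>
    rw [add_right_comm, qs_succ, qs_succ, aut_add]
    constructor <;> intro h <;> linear_combination h

theorem BB_mul_left (n n' m : Multiplicative (Fin 2 → ℤ)) :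
    BB (n * n') m = BB n m + BB n' m := by
  simp only [BB, toAdd_mul, Pi.add_apply]; push_cast; ring

theorem BB_mul_right (n m m' : Multiplicative (Fin 2 → ℤ)) :
    BB n (m * m') = BB n m + BB n m' := by
  simp only [BB, toAdd_mul, Pi.add_apply]; push_cast; ring

theorem action_eq (s : Multiplicative ℤ) : torusAction θ s = torusAut θ ^ s.toAdd := by
  simp [torusAction]

/-- The standard cocycle. -/
noncomputable def std (ε : ZMod 2) (φ : Fin 2 → ZMod 2) : Z (GG θ) :=
  ⟨fun p => qs θ ε φ p.1.right.toAdd p.2.left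
      + ε * BB p.1.left ((torusAut θ ^ p.1.right.toAdd) p.2.left), by
    intro g h j
    simp only [SemidirectProduct.mul_left, SemidirectProduct.mul_right, action_eq, toAdd_mul,
      map_mul, aut_add, qs_add, qs_mul, BB_mul_left, BB_mul_right]
    ring⟩

theorem std_apply (ε : ZMod 2) (φ : Fin 2 → ZMod 2) (x y : GG θ) :
    (std θ ε φ).1 (x, y) = qs θ ε φ x.right.toAdd y.left
      + ε * BB x.left ((torusAut θ ^ x.right.toAdd) y.left) := rfl

theorem ga_zpow (i : Fin 2) (k : ℤ) : ga θ i ^ k = SemidirectProduct.inl (e i ^ k) := by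
  rw [ga, map_zpow]

theorem std_inl (ε : ZMod 2) (φ : Fin 2 → ZMod 2) (n : Multiplicative (Fin 2 → ℤ)) (y : GG θ) :
    (std θ ε φ).1 (SemidirectProduct.inl n, y) = ε * BB n y.left := by
  simp [std_apply, qs_zero]

theorem pw_std (ε : ZMod 2) (φ : Fin 2 → ZMod 2) (i : Fin 2) (k : ℤ) :
    pw (std θ ε φ).1 (ga θ i) k = 0 := by
  have h1 : ∀ k : ℤ, (std θ ε φ).1 (ga θ i ^ k, ga θ i) = 0 := by
    intro k
    rw [ga_zpow, std_inl, ga, SemidirectProduct.left_inl]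
    fin_cases i <;> simp [BB, e]
  induction k using int_ind with
  | h0 =>
    have : (1 : GG θ) = SemidirectProduct.inl 1 := (map_one _).symm
    rw [pw_zero, this, std_inl]
    simp [BB]
  | h k => rw [pw_succ, h1, add_zero]

theorem qq_e (ε : ZMod 2) (φ : Fin 2 → ZMod 2) (i : Fin 2) : qq θ ε φ (e i) = φ i := by
  fin_cases i <;> simp [qq, e, tri]

theorem ev_std (ε : ZMod 2) (φ : Fin 2 → ZMod 2) :
    ev θ (std θ ε φ) = (ε, fun i => φ i - ε * (θ.1 0 i * θ.1 1 i)) := by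
  apply Prod.ext
  · simp only [ev, LinearMap.coe_mk, AddHom.coe_mk, ga, std_inl, SemidirectProduct.left_inl]
    simp [BB, e]
  · funext i
    simp only [ev, LinearMap.coe_mk, AddHom.coe_mk, defect, pw_std]
    rw [ga_zpow, ga_zpow, ← map_mul, std_inl, std_inl, std_apply]
    have h1 : qs θ ε φ 1 (e i) = φ i := by
      have := qs_succ θ ε φ 0 (e i)
      rw [zero_add, qs_zero, zpow_zero, MulAut.one_apply, qq_e, zero_add] at this
      exact this
    simp only [gt, ga, SemidirectProduct.left_inl, SemidirectProduct.left_inr,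
      SemidirectProduct.right_inr, toAdd_ofAdd, h1]
    simp [BB, e]

theorem ev_surj : Function.Surjective (ev θ) := by
  rintro ⟨ε, c⟩
  refine ⟨std θ ε (fun i => c i + ε * (θ.1 0 i * θ.1 1 i)), ?_⟩
  rw [ev_std]
  simp

theorem finrank_quot (r : ℕ) (hr : (MM θ).rank = r) :
    Module.finrank (ZMod 2) ((ZMod 2 × (Fin 2 → ZMod 2)) ⧸ LinearMap.range (DD θ)) = 3 - r := by
  have h1 := Submodule.finrank_quotient_add_finrank (LinearMap.range (DD θ))
  have h2 : Module.finrank (ZMod 2) (LinearMap.range (DD θ)) = r := by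
    rw [DD, LinearMap.range_comp, ← hr, ← Matrix.rank_transpose, Matrix.rank]
    exact (LinearEquiv.finrank_eq (Submodule.equivMapOfInjective _ LinearMap.inr_injective _)).symm
  rw [h2] at h1
  simp at h1
  omega

theorem main (r : ℕ) (hr : (MM θ).rank = r) :
    Nonempty ((groupCohomology (Rep.trivial (ZMod 2) (GG θ) (ZMod 2)) 2) ≃+
      (Fin (3 - r) → ZMod 2)) := by
  let A := Rep.trivial (ZMod 2) (GG θ) (ZMod 2)
  let π : groupCohomology.cocycles₂ A →ₗ[ZMod 2] groupCohomology A 2 := (groupCohomology.H2π A).hom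
  have hπ : Function.Surjective π := (ModuleCat.epi_iff_surjective _).1 inferInstance
  have hZ : ∀ f : GG θ × GG θ → ZMod 2, f ∈ groupCohomology.cocycles₂ A ↔ f ∈ Z (GG θ) :=
    fun f => groupCohomology.mem_cocycles₂_iff (A := A) f
  let ι : groupCohomology.cocycles₂ A →ₗ[ZMod 2] Z (GG θ) :=
    { toFun := fun f => ⟨f.1, (hZ f.1).1 f.2⟩
      map_add' := fun _ _ => rfl
      map_smul' := fun _ _ => rfl }
  have hι : Function.Surjective ι := fun f => ⟨⟨f.1, (hZ f.1).2 f.2⟩, rfl⟩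
  let ψ := (LinearMap.range (DD θ)).mkQ ∘ₗ ev θ ∘ₗ ι
  have hψ : Function.Surjective ψ :=
    (Submodule.mkQ_surjective _).comp ((ev_surj θ).comp hι)
  have hker : LinearMap.ker π = LinearMap.ker ψ := by
    ext f
    rw [LinearMap.mem_ker, LinearMap.mem_ker]
    have h1 : π f = 0 ↔ f.1 ∈ groupCohomology.coboundaries₂ A :=
      groupCohomology.H2π_eq_zero_iff f
    have h2 : ψ f = 0 ↔ ev θ (ι f) ∈ LinearMap.range (DD θ) := by
      change (LinearMap.range (DD θ)).mkQ (ev θ (ι f)) = 0 ↔ _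
      simp
    rw [h1, h2, ev_mem_iff]
    constructor
    · rintro ⟨h, hh⟩
      exact ⟨h, Subtype.ext hh.symm⟩
    · rintro ⟨h, hh⟩
      exact ⟨h, (congrArg Subtype.val hh).symm⟩
  let E : groupCohomology A 2 ≃ₗ[ZMod 2] _ :=
    (π.quotKerEquivOfSurjective hπ).symm ≪≫ₗ Submodule.quotEquivOfEq _ _ hker ≪≫ₗ
      ψ.quotKerEquivOfSurjective hψ
  let E2 := LinearEquiv.ofFinrankEq ((ZMod 2 × (Fin 2 → ZMod 2)) ⧸ LinearMap.range (DD θ))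
    (Fin (3 - r) → ZMod 2) (by rw [finrank_quot θ r hr]; simp)
  exact ⟨(E ≪≫ₗ E2).toAddEquiv⟩

end surj

end TorusH2

/-- `H²(G, 𝔽₂) ≅ 𝔽₂^(3 - r₂)`, where `r₂` is the rank of `θ - I` reduced mod `2`. -/
theorem torusBundle_H2_mod2 (θ : GL (Fin 2) ℤ) (r₂ : ℕ)
    (hr : (((θ : Matrix (Fin 2) (Fin 2) ℤ) - 1).map (Int.cast : ℤ → ZMod 2)).rank = r₂) :
    Nonempty ((groupCohomology (Rep.trivial (ZMod 2) (TorusBundleGroup θ) (ZMod 2)) 2) ≃+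
      (Fin (3 - r₂) → ZMod 2)) := by
  exact TorusH2.main θ r₂ hr
end

section
/- H³(G, 𝔽₂) ≅ 𝔽₂, and H^n(G, 𝔽₂) ≅ 0 for all n ≥ 4. -/
open CategoryTheory in
/-- The shift `(T f)(g) = s⁻¹ f(s g)` on a coinduced module. -/
noncomputable def tbShift {G : Type} [Group G] (N : Subgroup G) [N.Normal] (A : Rep.{0} (ZMod 2) G) (s : G) :
    Rep.coind N.subtype (Rep.res N.subtype A) ⟶ Rep.coind N.subtype (Rep.res N.subtype A) :=
  Rep.ofHom
    { toFun := fun f => ⟨fun g => A.ρ s⁻¹ (f.1 (s * g)), by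
        intro n h
        have hf := f.2 ⟨s * n.1 * s⁻¹, ‹N.Normal›.conj_mem n.1 n.2 s⟩ (s * h)
        simp only [Subgroup.subtype_apply, Rep.res_obj_ρ, MonoidHom.comp_apply] at hf ⊢
        have e : s * (n.1 * h) = s * n.1 * s⁻¹ * (s * h) := by group
        rw [e]
        erw [hf]
        simp only [← Module.End.mul_apply, ← map_mul]
        congr 2
        group⟩
      map_add' := fun f g => by
        ext x
        exact map_add (A.ρ s⁻¹) _ _
      map_smul' := fun r g => by
        ext x
        exact map_smul (A.ρ s⁻¹) _ _
      isIntertwining' := fun g => by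
        ext f x
        change A.ρ s⁻¹ (f.1 (s * x * g)) = A.ρ s⁻¹ (f.1 (s * (x * g)))
        rw [mul_assoc] }

open CategoryTheory in
lemma tbShift_apply {G : Type} [Group G] (N : Subgroup G) [N.Normal] (A : Rep.{0} (ZMod 2) G) (s : G)
    (f : Rep.coind N.subtype (Rep.res N.subtype A)) (g : G) :
    ((tbShift N A s).hom f).1 g = A.ρ s⁻¹ (f.1 (s * g)) := rfl

open CategoryTheory in
/-- The unit `A ⟶ Coind Res A`. -/
noncomputable def tbUnit {G : Type} [Group G] (N : Subgroup G) (A : Rep.{0} (ZMod 2) G) :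
    A ⟶ Rep.coind N.subtype (Rep.res N.subtype A) :=
  Rep.resCoindToHom N.subtype A _ (𝟙 _)

open CategoryTheory in
lemma tbUnit_apply {G : Type} [Group G] (N : Subgroup G) (A : Rep.{0} (ZMod 2) G)
    (a : A) (g : G) :
    ((tbUnit N A).hom a).1 g = A.ρ g a := rfl

lemma tbInt_solve {M : Type} [AddCommGroup M] (v : ℤ → M) :
    ∃ u : ℤ → M, ∀ k, u (k + 1) - u k = v k := by
  refine ⟨fun k => ∑ i ∈ Finset.Ico 0 k, v i - ∑ i ∈ Finset.Ico k 0, v i, fun k => ?_⟩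
  rcases le_or_gt 0 k with h | h
  · have e1 : Finset.Ico (0:ℤ) (k+1) = insert k (Finset.Ico 0 k) := by
      ext; simp; omega
    have e2 : Finset.Ico (k+1) (0:ℤ) = ∅ := by ext; simp; omega
    have e3 : Finset.Ico k (0:ℤ) = ∅ := by ext; simp; omega
    simp [e1, e2, e3]
  · have e1 : Finset.Ico k (0:ℤ) = insert k (Finset.Ico (k+1) 0) := by
      ext; simp; omega
    have e2 : Finset.Ico (0:ℤ) (k+1) = ∅ := by ext; simp; omega
    have e3 : Finset.Ico (0:ℤ) k = ∅ := by ext; simp; omega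
    simp [e1, e2, e3]

open CategoryTheory in
/-- The short complex `A ⟶ Coind Res A ⟶ Coind Res A`. -/
noncomputable def tbComplex {G : Type} [Group G] (π : G →* Multiplicative ℤ) (s : G)
    (hs : π s = Multiplicative.ofAdd 1) (A : Rep.{0} (ZMod 2) G) : ShortComplex (Rep (ZMod 2) G) :=
  ShortComplex.mk (tbUnit π.ker A) (tbShift π.ker A s - 𝟙 _) (by
    ext a g
    have : ((tbShift π.ker A s).hom ((tbUnit π.ker A).hom a)).1 g - ((tbUnit π.ker A).hom a).1 g = 0 := by
      rw [tbShift_apply, tbUnit_apply, tbUnit_apply, ← Module.End.mul_apply, ← map_mul]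
      simp
    exact this)

open CategoryTheory in
lemma tbComplex_shortExact {G : Type} [Group G] (π : G →* Multiplicative ℤ) (s : G)
    (hs : π s = Multiplicative.ofAdd 1) (A : Rep.{0} (ZMod 2) G) : (tbComplex π s hs A).ShortExact := by
  have hsub : ∀ (f : Rep.coind π.ker.subtype (Rep.res π.ker.subtype A)) (g : G),
      ((tbComplex π s hs A).g.hom f).1 g = A.ρ s⁻¹ (f.1 (s * g)) - f.1 g := fun f g => rfl
  have hN : ∀ (f : Rep.coind π.ker.subtype (Rep.res π.ker.subtype A)) (n g : G),
      π n = 1 → f.1 (n * g) = A.ρ n (f.1 g) := fun f n g hn => f.2 ⟨n, hn⟩ g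
  have hπ : ∀ g, ∃ n : G, π n = 1 ∧ g = n * s ^ (Multiplicative.toAdd (π g)) := by
    intro g
    refine ⟨g * (s ^ (Multiplicative.toAdd (π g)))⁻¹, ?_, by group⟩
    rw [map_mul, map_inv, map_zpow, hs, ← ofAdd_zsmul]
    simp
  have key : ∀ (B : Type) (w : G → B) , (∀ n g, π n = 1 → w (n * g) = w g) → ∀ g,
      w g = w (s ^ (Multiplicative.toAdd (π g))) := by
    intro B w hw g
    obtain ⟨n, hn, e⟩ := hπ g
    conv_lhs => rw [e]
    exact hw _ _ hn
  have hw : ∀ (f : Rep.coind π.ker.subtype (Rep.res π.ker.subtype A)) (g : G),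
      A.ρ g⁻¹ (f.1 g) = A.ρ (s ^ (Multiplicative.toAdd (π g)))⁻¹ (f.1 (s ^ (Multiplicative.toAdd (π g)))) := by
    intro f
    apply key _ (fun g => A.ρ g⁻¹ (f.1 g))
    intro n g hn
    simp only []
    rw [hN f n g hn, ← Module.End.mul_apply, ← map_mul]
    congr 2
    simp
  have hmono : Mono (tbComplex π s hs A).f := by
    rw [Rep.mono_iff_injective]
    intro a b hab
    have := congrFun (congrArg Subtype.val hab) 1
    have h2 : A.ρ 1 a = A.ρ 1 b := this
    rw [map_one] at h2
    exact h2
  have hepi : Epi (tbComplex π s hs A).g := by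
    rw [Rep.epi_iff_surjective]
    intro h
    obtain ⟨u, hu⟩ := tbInt_solve (M := A) (fun k => A.ρ (s ^ k)⁻¹ (h.1 (s ^ k)))
    let f : Rep.coind π.ker.subtype (Rep.res π.ker.subtype A) :=
      ⟨fun g => A.ρ g (u (Multiplicative.toAdd (π g))), by
        intro n g
        have hn : π n.1 = 1 := n.2
        simp only [Subgroup.subtype_apply, Rep.res_obj_ρ, MonoidHom.comp_apply, map_mul, hn, one_mul]
        rfl⟩
    refine ⟨f, ?_⟩
    apply Subtype.ext
    funext g
    rw [hsub]
    change A.ρ s⁻¹ (A.ρ (s * g) (u (Multiplicative.toAdd (π (s * g))))) - A.ρ g (u (Multiplicative.toAdd (π g))) = h.1 g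
    rw [← Module.End.mul_apply, ← map_mul, inv_mul_cancel_left, ← map_sub, map_mul, hs, toAdd_mul,
      toAdd_ofAdd, add_comm, hu, ← hw h g, ← Module.End.mul_apply, ← map_mul]
    simp
  have hex : (tbComplex π s hs A).Exact := by
    rw [← ShortComplex.exact_map_iff_of_faithful _ (forget₂ (Rep (ZMod 2) G) (ModuleCat (ZMod 2))),
      ShortComplex.moduleCat_exact_iff]
    intro (f : Rep.coind π.ker.subtype (Rep.res π.ker.subtype A)) hf
    have hf' : ∀ g, A.ρ s⁻¹ (f.1 (s * g)) = f.1 g := by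
      intro g
      have : ((tbComplex π s hs A).g.hom f).1 g = 0 := congrFun (congrArg Subtype.val hf) g
      exact sub_eq_zero.1 ((hsub f g).symm.trans this)
    have hf1 : ∀ g, f.1 (s * g) = A.ρ s (f.1 g) := by
      intro g
      rw [← hf' g, ← Module.End.mul_apply, ← map_mul]
      simp
    refine ⟨f.1 1, ?_⟩
    apply Subtype.ext
    funext g
    change A.ρ g (f.1 1) = f.1 g
    have h3 : ∀ k : ℤ, A.ρ (s ^ k)⁻¹ (f.1 (s ^ k)) = f.1 1 := by
      intro k
      have hstep : ∀ k : ℤ, A.ρ (s ^ (k+1))⁻¹ (f.1 (s ^ (k+1))) = A.ρ (s ^ k)⁻¹ (f.1 (s ^ k)) := by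
        intro k
        rw [show s ^ (k+1) = s * s ^ k by rw [add_comm, zpow_add, zpow_one], hf1,
          ← Module.End.mul_apply, ← map_mul]
        congr 2
        simp
      induction k using Int.induction_on with
      | zero => simp
      | succ k ih => rw [hstep, ih]
      | pred k ih => rw [← ih, ← hstep (-(k:ℤ) - 1)]; simp
    rw [← h3 (Multiplicative.toAdd (π g)), ← hw f g, ← Module.End.mul_apply, ← map_mul]
    simp
  exact ⟨hex⟩

lemma tbF2_end {M : Type} [AddCommGroup M] (e : M ≃+ ZMod 2) (φ : M →+ M)
    (h : Function.Injective φ) (x : M) : φ x = x := by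
  by_cases hx : x = 0
  · simp [hx]
  · have h1 : φ x ≠ 0 := fun h0 => hx (h (by simpa using h0))
    have h2 : e x ≠ 0 := by simpa using hx
    have h3 : e (φ x) ≠ 0 := by simpa using h1
    apply e.injective
    generalize e x = a at *
    generalize e (φ x) = b at *
    revert a b; decide

/-- cohomological dimension at most `d` (mod 2) and top cohomology `𝔽₂`. -/
def tbP (G : Type) [Group G] (d : ℕ) : Prop :=
  (∀ (A : Rep.{0} (ZMod 2) G) (n : ℕ), d < n → CategoryTheory.Limits.IsZero (groupCohomology A n)) ∧
  Nonempty (groupCohomology (Rep.trivial (ZMod 2) G (ZMod 2)) d ≃+ ZMod 2)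

open CategoryTheory groupCohomology in
lemma tbMap_sub {G : Type} [Group G] {A B : Rep.{0} (ZMod 2) G} (f g : A ⟶ B) (n : ℕ) :
    (functor (ZMod 2) G n).map (f - g) = (functor (ZMod 2) G n).map f - (functor (ZMod 2) G n).map g := by
  have := (cochainsFunctor (ZMod 2) G ⋙ HomologicalComplex.homologyFunctor _ _ n).map_sub
    (f := f) (g := g)
  exact this

open CategoryTheory groupCohomology in
lemma tbP_step {G : Type} [Group G] (π : G →* Multiplicative ℤ) (s : G)
    (hs : π s = Multiplicative.ofAdd 1) (d : ℕ) (h : tbP π.ker d) : tbP G (d + 1) := by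
  obtain ⟨hv, ⟨e⟩⟩ := h
  have hcoind : ∀ (A : Rep.{0} (ZMod 2) G) (n : ℕ), d < n →
      Limits.IsZero (groupCohomology (tbComplex π s hs A).X₂ n) := fun A n hn =>
    (hv (Rep.res π.ker.subtype A) n hn).of_iso (coindIso _ n)
  refine ⟨fun A n hn => ?_, ?_⟩
  · obtain ⟨n, rfl⟩ : ∃ m, n = m + 1 := ⟨n - 1, by omega⟩
    have hX := tbComplex_shortExact π s hs A
    have := epi_δ_of_isZero hX n (hcoind A (n+1) (by omega))
    have h3 : Limits.IsZero (groupCohomology (tbComplex π s hs A).X₃ n) := hcoind A n (by omega)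
    exact @Limits.IsZero.of_epi _ _ _ _ _ (δ hX n (n+1) rfl) this h3
  · let A := Rep.trivial (ZMod 2) G (ZMod 2)
    have hX := tbComplex_shortExact π s hs A
    have hepi := epi_δ_of_isZero hX d (hcoind A (d+1) (by omega))
    let e3 : groupCohomology (tbComplex π s hs A).X₃ d ≃+ ZMod 2 :=
      ((coindIso (Rep.res π.ker.subtype A) d).toLinearEquiv.toAddEquiv).trans e
    have hinv : tbShift π.ker A s ≫ tbShift π.ker A s⁻¹ = 𝟙 _ := by
      ext f g
      have : ((tbShift π.ker A s⁻¹).hom ((tbShift π.ker A s).hom f)).1 g = f.1 g := by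
        rw [tbShift_apply, tbShift_apply, ← Module.End.mul_apply, ← map_mul]
        simp
      exact this
    have hT : (functor (ZMod 2) G d).map (tbShift π.ker A s) = 𝟙 _ := by
      have hc : (functor (ZMod 2) G d).map (tbShift π.ker A s) ≫
          (functor (ZMod 2) G d).map (tbShift π.ker A s⁻¹) = 𝟙 _ := by
        rw [← Functor.map_comp, hinv, CategoryTheory.Functor.map_id]
      ext x
      refine tbF2_end e3 ((functor (ZMod 2) G d).map (tbShift π.ker A s)).hom.toAddMonoidHom ?_ x
      intro a b hab
      have ha := ConcreteCategory.congr_hom hc a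
      have hb := ConcreteCategory.congr_hom hc b
      exact ha.symm.trans ((congrArg
        ((functor (ZMod 2) G d).map (tbShift π.ker A s⁻¹)).hom hab).trans hb)
    have h0 : (functor (ZMod 2) G d).map (tbComplex π s hs A).g = 0 := by
      have : (functor (ZMod 2) G d).map (tbShift π.ker A s - 𝟙 _) = 0 := by
        rw [tbMap_sub, hT, CategoryTheory.Functor.map_id, sub_self]
      exact this
    have hmono : Mono (δ hX d (d+1) rfl) :=
      (mapShortComplex₃_exact hX (i := d) (j := d+1) rfl).mono_g h0
    have : IsIso (δ hX d (d+1) rfl) := isIso_of_mono_of_epi _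
    exact ⟨((asIso (δ hX d (d+1) rfl)).toLinearEquiv.toAddEquiv.symm).trans e3⟩

open CategoryTheory groupCohomology in
lemma tbP_zero {G : Type} [Group G] [Subsingleton G] : tbP G 0 := by
  refine ⟨fun A n hn => ?_, ⟨?_⟩⟩
  · obtain ⟨n, rfl⟩ : ∃ m, n = m + 1 := ⟨n - 1, by omega⟩
    exact isZero_groupCohomology_succ_of_subsingleton A n
  · exact (H0IsoOfIsTrivial (Rep.trivial (ZMod 2) G (ZMod 2))).toLinearEquiv.toAddEquiv

lemma tbP_torus (θ : GL (Fin 2) ℤ) : tbP (TorusBundleGroup θ) 3 := by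
  let V := Multiplicative (Fin 2 → ℤ)
  let π₁ : TorusBundleGroup θ →* Multiplicative ℤ :=
    (SemidirectProduct.rightHom : SemidirectProduct V (Multiplicative ℤ) (torusAction θ) →* _)
  let c : Fin 2 → V →* Multiplicative ℤ := fun i => AddMonoidHom.toMultiplicative (Pi.evalAddMonoidHom (fun _ => ℤ) i)
  have hπ₁ : ∀ g : TorusBundleGroup θ, π₁ g = g.right := fun _ => rfl
  let lft : π₁.ker →* V :=
    { toFun := fun g => g.1.left
      map_one' := rfl
      map_mul' := fun a b => by
        have h1 : a.1.right = 1 := a.2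
        have : (a.1 * b.1).left = a.1.left * (torusAction θ a.1.right) b.1.left :=
          SemidirectProduct.mul_left _ _
        rw [h1] at this
        simpa using this }
  let inl : V → π₁.ker := fun v =>
    ⟨(SemidirectProduct.inl v : SemidirectProduct V (Multiplicative ℤ) (torusAction θ)), rfl⟩
  have hlft : ∀ v, lft (inl v) = v := fun v => rfl
  have hlinj : Function.Injective lft := by
    intro a b hab
    apply Subtype.ext
    have h1 : a.1.right = 1 := a.2
    have h2 : b.1.right = 1 := b.2
    exact SemidirectProduct.ext hab (h1.trans h2.symm)
  refine tbP_step π₁ (SemidirectProduct.inr (Multiplicative.ofAdd 1) :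
    SemidirectProduct V (Multiplicative ℤ) (torusAction θ)) rfl 2 ?_
  let π₂ : π₁.ker →* Multiplicative ℤ := (c 0).comp lft
  refine tbP_step π₂ (inl (Multiplicative.ofAdd ![1, 0])) rfl 1 ?_
  let π₃ : π₂.ker →* Multiplicative ℤ := ((c 1).comp lft).comp π₂.ker.subtype
  refine tbP_step π₃ ⟨inl (Multiplicative.ofAdd ![0, 1]), rfl⟩ rfl 0 ?_
  have : Subsingleton π₃.ker := by
    refine ⟨fun a b => ?_⟩
    apply Subtype.ext
    apply Subtype.ext
    apply hlinj
    have ha0 : c 0 (lft a.1.1) = 1 := a.1.2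
    have hb0 : c 0 (lft b.1.1) = 1 := b.1.2
    have ha1 : c 1 (lft a.1.1) = 1 := a.2
    have hb1 : c 1 (lft b.1.1) = 1 := b.2
    have e0 : (Multiplicative.toAdd (lft a.1.1)) 0 = (Multiplicative.toAdd (lft b.1.1)) 0 :=
      ha0.trans hb0.symm
    have e1 : (Multiplicative.toAdd (lft a.1.1)) 1 = (Multiplicative.toAdd (lft b.1.1)) 1 :=
      ha1.trans hb1.symm
    apply Multiplicative.toAdd.injective
    funext i
    fin_cases i
    · exact e0
    · exact e1
  exact tbP_zero

/-- `H³(G, 𝔽₂) ≅ 𝔽₂`, and `H^n(G, 𝔽₂) = 0` for all `n ≥ 4`. -/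
theorem torusBundle_H3_and_Hn_mod2 (θ : GL (Fin 2) ℤ) :
    Nonempty ((groupCohomology (Rep.trivial (ZMod 2) (TorusBundleGroup θ) (ZMod 2)) 3) ≃+ ZMod 2) ∧
    ∀ n : ℕ, 4 ≤ n → Subsingleton (groupCohomology (Rep.trivial (ZMod 2) (TorusBundleGroup θ) (ZMod 2)) n) := by
  obtain ⟨h1, h2⟩ := tbP_torus θ
  exact ⟨h2, fun n hn => ModuleCat.subsingleton_of_isZero (h1 _ n (by omega))⟩
end

section
/- Let p be an odd prime and let r_p be the rank over 𝔽_p of the reduction modulo p of the integer matrix θ − I. If det θ = 1 then H²(G, 𝔽_p) ≅ (𝔽_p)^{3 − r_p}, and if det θ = −1 then H²(G, 𝔽_p) ≅ (𝔽_p)^{2 − r_p}. -/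
namespace TB

/-- A (trivial coefficient) 2-cocycle, as a function. -/
def IsCoc {G k : Type*} [Group G] [AddCommGroup k] (f : G × G → k) : Prop :=
  ∀ g h j : G, f (g * h, j) + f (g, h) = f (h, j) + f (g, h * j)

/-- The cochain `h` bounds `f`. -/
def Bounds {G k : Type*} [Group G] [AddCommGroup k] (h : G → k) (f : G × G → k) : Prop :=
  ∀ g j : G, f (g, j) = h j - h (g * j) + h g

theorem H2_equiv {k G : Type} [Field k] [Group G] {W : Type} [AddCommGroup W] [Module k W]
    [FiniteDimensional k W] (F : W →ₗ[k] (G × G → k)) (hF : ∀ w, IsCoc (F w))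
    (hs : ∀ f : G × G → k, IsCoc f → ∃ w h, Bounds h (f - F w))
    (K : Submodule k W) (hK : ∀ w, w ∈ K ↔ ∃ h, Bounds h (F w)) (d : ℕ)
    (hd : Module.finrank k K + d = Module.finrank k W) :
    Nonempty (groupCohomology (Rep.trivial k G k) 2 ≃+ (Fin d → k)) := by
  have hc : ∀ f : G × G → k, f ∈ groupCohomology.cocycles₂ (Rep.trivial k G k) ↔ IsCoc f := by
    intro f
    rw [groupCohomology.mem_cocycles₂_iff]
    rfl
  have hb : ∀ f : G × G → k, f ∈ groupCohomology.coboundaries₂ (Rep.trivial k G k) ↔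
      ∃ h, Bounds h f := by
    intro f
    constructor
    · rintro ⟨h, rfl⟩
      exact ⟨h, fun g j => rfl⟩
    · rintro ⟨h, hh⟩
      exact ⟨h, funext fun x => (hh x.1 x.2).symm⟩
  let F' : W →ₗ[k] groupCohomology.cocycles₂ (Rep.trivial k G k) :=
    LinearMap.codRestrict _ F (fun w => (hc _).2 (hF w))
  let P : W →ₗ[k] groupCohomology (Rep.trivial k G k) 2 :=
    (groupCohomology.H2π (Rep.trivial k G k)).hom.comp F'
  have hker : LinearMap.ker P = K := by
    ext w
    rw [hK, LinearMap.mem_ker, ← hb]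
    exact groupCohomology.H2π_eq_zero_iff (F' w)
  have hsurj : Function.Surjective P := by
    intro x
    induction x using groupCohomology.H2_induction_on with
    | h x =>
      obtain ⟨w, h, hw⟩ := hs x.1 ((hc _).1 x.2)
      refine ⟨w, ?_⟩
      symm
      exact (groupCohomology.H2π_eq_iff x (F' w)).2 ((hb _).2 ⟨h, hw⟩)
  have e := P.quotKerEquivOfSurjective hsurj
  rw [hker] at e
  have h1 := Submodule.finrank_quotient_add_finrank K
  have h2 : Module.finrank k (W ⧸ K) = d := by omega
  have e2 : (W ⧸ K) ≃ₗ[k] (Fin d → k) := LinearEquiv.ofFinrankEq _ _ (by simp [h2])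
  exact ⟨(e.symm.trans e2).toAddEquiv⟩

/-- The central extension attached to a cocycle. -/
@[ext]
structure Ext {G k : Type*} [Group G] [AddCommGroup k] (f : G × G → k) (hf : IsCoc f) where
  val : k
  pr : G

section
variable {G k : Type*} [Group G] [AddCommGroup k] {f : G × G → k} {hf : IsCoc f}

theorem IsCoc.one_left (hf : IsCoc f) (g : G) : f (1, g) = f (1, 1) := by
  have := hf 1 1 g
  simp only [one_mul] at this
  exact (add_left_cancel this).symm

theorem IsCoc.one_right (hf : IsCoc f) (g : G) : f (g, 1) = f (1, 1) := by
  have := hf g 1 1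
  simp only [mul_one] at this
  exact add_right_cancel this

instance : Mul (Ext f hf) := ⟨fun x y => ⟨x.val + y.val + f (x.pr, y.pr), x.pr * y.pr⟩⟩
instance : One (Ext f hf) := ⟨⟨- f (1, 1), 1⟩⟩
instance : Inv (Ext f hf) := ⟨fun x => ⟨- x.val - f (1, 1) - f (x.pr⁻¹, x.pr), x.pr⁻¹⟩⟩

theorem mul_val (x y : Ext f hf) : (x * y).val = x.val + y.val + f (x.pr, y.pr) := rfl
theorem mul_pr (x y : Ext f hf) : (x * y).pr = x.pr * y.pr := rfl
theorem one_val : (1 : Ext f hf).val = - f (1, 1) := rfl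
theorem one_pr : (1 : Ext f hf).pr = 1 := rfl

instance : Group (Ext f hf) :=
  Group.ofLeftAxioms
    (by
      intro x y z
      ext
      · simp only [mul_val, mul_pr]
        have := hf x.pr y.pr z.pr
        have h2 : f (x.pr * y.pr, z.pr) = f (y.pr, z.pr) + f (x.pr, y.pr * z.pr) - f (x.pr, y.pr) :=
          eq_sub_of_add_eq this
        rw [h2]; abel
      · simp only [mul_pr, mul_assoc])
    (by
      intro x
      ext
      · simp only [mul_val, one_val, one_pr, hf.one_left]; abel
      · simp only [mul_pr, one_pr, one_mul])
    (by
      intro x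
      ext
      · change - x.val - f (1, 1) - f (x.pr⁻¹, x.pr) + x.val + f (x.pr⁻¹, x.pr) = - f (1, 1)
        abel
      · change x.pr⁻¹ * x.pr = 1
        simp)

/-- The projection. -/
def pi : Ext f hf →* G where
  toFun x := x.pr
  map_one' := rfl
  map_mul' _ _ := rfl

/-- The central inclusion. -/
def cen (x : k) : Ext f hf := ⟨x - f (1, 1), 1⟩

theorem cen_mul_val (x : k) (y : Ext f hf) : (cen x * y).val = x + y.val := by
  simp only [mul_val, cen, hf.one_left]; abel

theorem cen_mul_pr (x : k) (y : Ext f hf) : (cen x * y).pr = y.pr := by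
  simp only [mul_pr, cen, one_mul]

theorem cen_add (x y : k) : (cen (x + y) : Ext f hf) = cen x * cen y := by
  ext
  · rw [cen_mul_val]; simp only [cen]; abel
  · rw [cen_mul_pr]; rfl

theorem cen_zero : (cen 0 : Ext f hf) = 1 := by
  ext
  · simp [cen, one_val]
  · rfl

theorem cen_comm (x : k) (y : Ext f hf) : y * cen x = cen x * y := by
  ext
  · simp only [mul_val, cen, hf.one_left, hf.one_right]; abel
  · simp only [mul_pr, cen, one_mul, mul_one]

theorem cen_inj {x y : k} (h : (cen x : Ext f hf) = cen y) : x = y := by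
  have := congrArg Ext.val h
  simpa [cen] using this

theorem exists_cen {x y : Ext f hf} (h : pi x = pi y) : ∃ c, x = cen c * y := by
  refine ⟨x.val - y.val, ?_⟩
  ext
  · rw [cen_mul_val]; abel
  · rw [cen_mul_pr]; exact h

theorem comm_cen (X Y : Ext f hf) (h : pi X * pi Y = pi Y * pi X) :
    X * Y = cen (f (pi X, pi Y) - f (pi Y, pi X)) * (Y * X) := by
  ext
  · rw [cen_mul_val]
    simp only [mul_val, pi, MonoidHom.coe_mk, OneHom.coe_mk]; abel
  · rw [cen_mul_pr]; exact h

/-- The commutator pairing is invariant under conjugation. -/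
theorem kappa_conj (hf : IsCoc f) (t x y x' y' : G) (h : x * y = y * x)
    (hx : t * x = x' * t) (hy : t * y = y' * t) :
    f (x', y') - f (y', x') = f (x, y) - f (y, x) := by
  let X : Ext f hf := ⟨0, x⟩
  let Y : Ext f hf := ⟨0, y⟩
  let T : Ext f hf := ⟨0, t⟩
  have h1 := comm_cen X Y h
  have ex : pi (T * X * T⁻¹) = x' := by
    rw [map_mul, map_mul, map_inv, mul_inv_eq_iff_eq_mul]; exact hx
  have ey : pi (T * Y * T⁻¹) = y' := by
    rw [map_mul, map_mul, map_inv, mul_inv_eq_iff_eq_mul]; exact hy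
  have e1 : T * X * T⁻¹ * (T * Y * T⁻¹) = T * (X * Y) * T⁻¹ := by group
  have e2 : T * Y * T⁻¹ * (T * X * T⁻¹) = T * (Y * X) * T⁻¹ := by group
  have h2 := comm_cen (T * X * T⁻¹) (T * Y * T⁻¹) (by
    have : pi (X * Y) = pi (Y * X) := h
    rw [← map_mul, ← map_mul, e1, e2]
    simp only [map_mul] at this ⊢
    rw [this])
  rw [ex, ey, e1, e2, h1] at h2
  have h3 : T * (cen (f (pi X, pi Y) - f (pi Y, pi X)) * (Y * X)) * T⁻¹ =
      cen (f (pi X, pi Y) - f (pi Y, pi X)) * (T * (Y * X) * T⁻¹) := by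
    rw [← mul_assoc, cen_comm]; group
  rw [h3] at h2
  exact (cen_inj (mul_right_cancel h2)).symm

theorem kappa_add (hf : IsCoc f) (x y z : G) (hxz : x * z = z * x) (hyz : y * z = z * y)  :
    f (x * y, z) - f (z, x * y) = (f (x, z) - f (z, x)) + (f (y, z) - f (z, y)) := by
  have h1 := eq_sub_of_add_eq (hf x y z)
  have h2 := eq_sub_of_add_eq' (hf z x y).symm
  have h3 := eq_sub_of_add_eq (hf x z y)
  rw [h1, h2, ← hxz, h3, hyz]
  abel

end

/-! ### Signed sums -/

/-- The signed sum of `g` over the integers from `0` to `m - 1`. -/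
def zs {A : Type*} [AddCommGroup A] (g : ℤ → A) : ℤ → A
  | Int.ofNat n => ∑ i ∈ Finset.range n, g i
  | Int.negSucc n => - ∑ i ∈ Finset.range (n + 1), g (-(i + 1))

section
variable {A : Type*} [AddCommGroup A]

theorem zs_zero (g : ℤ → A) : zs g 0 = 0 := by
  change zs g (Int.ofNat 0) = 0
  simp [zs]

theorem zs_succ (g : ℤ → A) (m : ℤ) : zs g (m + 1) = zs g m + g m := by
  match m with
  | Int.ofNat n =>
    change zs g (Int.ofNat (n + 1)) = _
    simp [zs, Finset.sum_range_succ]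
  | Int.negSucc 0 =>
    change zs g (Int.ofNat 0) = _
    simp [zs]
  | Int.negSucc (n + 1) =>
    change zs g (Int.negSucc n) = _
    simp only [zs]
    rw [Finset.sum_range_succ _ (n + 1)]
    have : Int.negSucc (n + 1) = -(((n + 1 : ℕ) : ℤ) + 1) := by simp [Int.negSucc_eq]
    rw [this]
    abel

theorem zs_unique (g F : ℤ → A) (h0 : F 0 = 0) (h : ∀ m, F (m + 1) = F m + g m) (m : ℤ) :
    zs g m = F m := by
  induction m using Int.induction_on with
  | zero => rw [zs_zero, h0]
  | succ i ih => rw [zs_succ, h, ih]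
  | pred i ih =>
    have h1 := zs_succ g (-i - 1)
    have h2 := h (-i - 1)
    rw [sub_add_cancel] at h1 h2
    rw [h1, h2] at ih
    exact add_right_cancel ih

theorem zs_add (g : ℤ → A) (m m' : ℤ) :
    zs g (m + m') = zs g m + zs (fun i => g (m + i)) m' := by
  have := zs_unique (fun i => g (m + i)) (fun i => zs g (m + i) - zs g m) (by simp)
    (by intro i; simp only [← add_assoc, zs_succ]; abel) m'
  rw [this]; abel

theorem zs_add_fun (g g' : ℤ → A) (m : ℤ) :
    zs (fun i => g i + g' i) m = zs g m + zs g' m :=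
  zs_unique _ (fun m => zs g m + zs g' m) (by simp [zs_zero])
    (by intro i; simp only [zs_succ]; abel) m

theorem zs_mul {k : Type*} [CommRing k] (c : k) (g : ℤ → k) (m : ℤ) :
    zs (fun i => c * g i) m = c * zs g m :=
  zs_unique _ (fun m => c * zs g m) (by simp [zs_zero])
    (by intro i; simp only [zs_succ]; ring) m
end

/-! ### The torus bundle group -/

/-- The lattice. -/
abbrev NN := Multiplicative (Fin 2 → ℤ)

/-- The torus bundle group, reducibly. -/
abbrev GG (θ : GL (Fin 2) ℤ) := SemidirectProduct NN (Multiplicative ℤ) (torusAction θ)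

theorem torusAut_apply (θ : GL (Fin 2) ℤ) (n : NN) :
    torusAut θ n = Multiplicative.ofAdd ((θ : Matrix (Fin 2) (Fin 2) ℤ).mulVec n.toAdd) := rfl

theorem action_apply (θ : GL (Fin 2) ℤ) (m : Multiplicative ℤ) :
    torusAction θ m = torusAut θ ^ m.toAdd := rfl

section
variable {k : Type} [CommRing k]

/-- The linear form on the lattice. -/
def lin (φ : Fin 2 → k) (n : NN) : k := φ 0 * (n.toAdd 0 : ℤ) + φ 1 * (n.toAdd 1 : ℤ)

theorem lin_mul (φ : Fin 2 → k) (n n' : NN) : lin φ (n * n') = lin φ n + lin φ n' := by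
  simp [lin, toAdd_mul]; ring

theorem lin_one (φ : Fin 2 → k) : lin φ 1 = 0 := by
  simp [lin]

theorem lin_torusAut (θ : GL (Fin 2) ℤ) (φ : Fin 2 → k) (n : NN) :
    lin φ (torusAut θ n) =
      lin (Matrix.vecMul φ ((θ : Matrix (Fin 2) (Fin 2) ℤ).map (Int.cast : ℤ → k))) n := by
  rw [torusAut_apply]
  simp [lin, Matrix.mulVec, Matrix.vecMul, dotProduct, Fin.sum_univ_two]
  ring

/-- Iterated sums of a linear form along the action. -/
noncomputable def EE (θ : GL (Fin 2) ℤ) (φ : Fin 2 → k) (m : ℤ) (n : NN) : k :=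
  zs (fun i => lin φ ((torusAut θ ^ i) n)) m

theorem EE_mul (θ : GL (Fin 2) ℤ) (φ : Fin 2 → k) (m : ℤ) (n n' : NN) :
    EE θ φ m (n * n') = EE θ φ m n + EE θ φ m n' := by
  simp only [EE, map_mul, lin_mul, zs_add_fun]

theorem EE_add (θ : GL (Fin 2) ℤ) (φ : Fin 2 → k) (m m' : ℤ) (n : NN) :
    EE θ φ (m + m') n = EE θ φ m' n + EE θ φ m ((torusAut θ ^ m') n) := by
  rw [add_comm, EE, zs_add, EE, EE]
  congr 2
  funext i
  rw [← MulAut.mul_apply, ← zpow_add, add_comm]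

theorem EE_one (θ : GL (Fin 2) ℤ) (φ : Fin 2 → k) (n : NN) : EE θ φ 1 n = lin φ n := by
  have := zs_succ (fun i => lin φ ((torusAut θ ^ i) n)) 0
  rw [zs_zero, zero_add, zero_add] at this
  simpa only [EE, zpow_zero, MulAut.one_apply] using this

theorem EE_zero (θ : GL (Fin 2) ℤ) (φ : Fin 2 → k) (n : NN) : EE θ φ 0 n = 0 := zs_zero _

/-- The cocycle attached to a linear form. -/
noncomputable def cocLin (θ : GL (Fin 2) ℤ) : (Fin 2 → k) →ₗ[k] (GG θ × GG θ → k) where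
  toFun φ x := EE θ φ x.1.right.toAdd x.2.left
  map_add' φ ψ := by
    funext x
    simp only [EE, Pi.add_apply, ← zs_add_fun]
    congr 1; funext i; simp [lin]; ring
  map_smul' c φ := by
    funext x
    simp only [EE, Pi.smul_apply, smul_eq_mul, RingHom.id_apply, ← zs_mul]
    congr 1; funext i; simp [lin]; ring

theorem cocLin_apply (θ : GL (Fin 2) ℤ) (φ : Fin 2 → k) (g h : GG θ) :
    cocLin θ φ (g, h) = EE θ φ g.right.toAdd h.left := rfl

theorem cocLin_coc (θ : GL (Fin 2) ℤ) (φ : Fin 2 → k) : IsCoc (cocLin θ φ) := by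
  intro g h j
  simp only [cocLin_apply, SemidirectProduct.mul_right, SemidirectProduct.mul_left, toAdd_mul,
    EE_mul, EE_add, action_apply]
  ring

/-- The determinant form. -/
def om (x y : NN) : k :=
  ((x.toAdd 0 : ℤ) : k) * ((y.toAdd 1 : ℤ) : k) - ((x.toAdd 1 : ℤ) : k) * ((y.toAdd 0 : ℤ) : k)

theorem om_mul_left (x y z : NN) : (om (x * y) z : k) = om x z + om y z := by
  simp [om]; ring

theorem om_mul_right (x y z : NN) : (om x (y * z) : k) = om x y + om x z := by
  simp [om]; ring

theorem om_torusAut (θ : GL (Fin 2) ℤ) (x y : NN) :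
    (om (torusAut θ x) (torusAut θ y) : k) =
      ((θ : Matrix (Fin 2) (Fin 2) ℤ).det : ℤ) * om x y := by
  simp [om, torusAut_apply, Matrix.mulVec, dotProduct, Fin.sum_univ_two, Matrix.det_fin_two]
  ring

theorem om_zpow (θ : GL (Fin 2) ℤ) (h : (θ : Matrix (Fin 2) (Fin 2) ℤ).det = 1) (m : ℤ)
    (x y : NN) : (om ((torusAut θ ^ m) x) ((torusAut θ ^ m) y) : k) = om x y := by
  have h1 : ∀ x y, (om (torusAut θ x) (torusAut θ y) : k) = om x y := by
    intro x y; rw [om_torusAut, h]; simp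
  induction m using Int.induction_on with
  | zero => simp
  | succ i ih => rw [add_comm, zpow_add, zpow_one, MulAut.mul_apply, MulAut.mul_apply, h1, ih]
  | pred i ih =>
    rw [← h1, ← MulAut.mul_apply, ← MulAut.mul_apply, ← zpow_one_add]
    simpa using ih

/-- The cocycle attached to the determinant form. -/
noncomputable def cocDet (θ : GL (Fin 2) ℤ) (u : k) : k →ₗ[k] (GG θ × GG θ → k) where
  toFun c x := c * (u * om x.1.left (torusAction θ x.1.right x.2.left))
  map_add' c d := by funext x; simp only [Pi.add_apply]; ring
  map_smul' c d := by funext x; simp only [Pi.smul_apply, smul_eq_mul, RingHom.id_apply]; ring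

theorem cocDet_apply (θ : GL (Fin 2) ℤ) (u c : k) (g h : GG θ) :
    cocDet θ u c (g, h) = c * (u * om g.left ((torusAut θ ^ g.right.toAdd) h.left)) := rfl

theorem cocDet_coc (θ : GL (Fin 2) ℤ) (h : (θ : Matrix (Fin 2) (Fin 2) ℤ).det = 1) (u c : k) :
    IsCoc (cocDet θ u c) := by
  intro g h' j
  simp only [cocDet_apply, SemidirectProduct.mul_right, SemidirectProduct.mul_left, toAdd_mul,
    action_apply, map_mul, om_mul_left, om_mul_right, zpow_add, MulAut.mul_apply, om_zpow θ h]
  ring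

/-- First basis vector. -/
def a0 : NN := Multiplicative.ofAdd ![1, 0]
/-- Second basis vector. -/
def a1 : NN := Multiplicative.ofAdd ![0, 1]

theorem basis_eq (n : NN) : n = a0 ^ (n.toAdd 0) * a1 ^ (n.toAdd 1) := by
  apply Multiplicative.toAdd.injective
  funext i
  fin_cases i <;> simp [a0, a1]

theorem lin_a0 (φ : Fin 2 → k) : lin φ a0 = φ 0 := by simp [lin, a0]
theorem lin_a1 (φ : Fin 2 → k) : lin φ a1 = φ 1 := by simp [lin, a1]

theorem lin_of_add (ψ : NN → k) (h : ∀ n n', ψ (n * n') = ψ n + ψ n') (n : NN) :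
    ψ n = lin ![ψ a0, ψ a1] n := by
  let Ψ : NN →* Multiplicative k :=
    MonoidHom.mk' (fun n => Multiplicative.ofAdd (ψ n)) (fun a b => by rw [h]; rfl)
  have h1 : Ψ n = Ψ a0 ^ (n.toAdd 0) * Ψ a1 ^ (n.toAdd 1) := by
    rw [← map_zpow, ← map_zpow, ← map_mul, ← basis_eq]
  have h2 := congrArg Multiplicative.toAdd h1
  rw [toAdd_mul, toAdd_zpow, toAdd_zpow] at h2
  change ψ n = (n.toAdd 0) • ψ a0 + (n.toAdd 1) • ψ a1 at h2
  rw [h2]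
  simp [lin, mul_comm]

/-- The stable letter. -/
noncomputable def tt (θ : GL (Fin 2) ℤ) : GG θ := SemidirectProduct.inr (Multiplicative.ofAdd 1)

/-- Inclusion of the lattice. -/
noncomputable def il (θ : GL (Fin 2) ℤ) : NN →* GG θ := SemidirectProduct.inl

theorem tt_il (θ : GL (Fin 2) ℤ) (n : NN) : tt θ * il θ n = il θ (torusAut θ n) * tt θ := by
  have h : torusAction θ (Multiplicative.ofAdd 1) = torusAut θ := by
    rw [action_apply]; simp
  ext1
  · simp [tt, il, h]
  · simp [tt, il]

theorem il_comm (θ : GL (Fin 2) ℤ) (n n' : NN) : il θ n * il θ n' = il θ n' * il θ n := by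
  rw [← map_mul, mul_comm, map_mul]

theorem decomp (θ : GL (Fin 2) ℤ) (g : GG θ) : il θ g.left * tt θ ^ g.right.toAdd = g := by
  rw [tt, ← map_zpow, il]
  have : (Multiplicative.ofAdd (1 : ℤ)) ^ g.right.toAdd = g.right := by
    apply Multiplicative.toAdd.injective; simp
  rw [this, SemidirectProduct.inl_left_mul_inr_right]

theorem kappa_eq (θ : GL (Fin 2) ℤ) (f : GG θ × GG θ → k) (hf : IsCoc f) (x y : NN) :
    f (il θ x, il θ y) - f (il θ y, il θ x) =
      (f (il θ a0, il θ a1) - f (il θ a1, il θ a0)) * om x y := by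
  have hadd : ∀ z n n', f (il θ (n * n'), il θ z) - f (il θ z, il θ (n * n')) =
      (f (il θ n, il θ z) - f (il θ z, il θ n)) + (f (il θ n', il θ z) - f (il θ z, il θ n')) := by
    intro z n n'
    rw [map_mul]
    exact kappa_add hf _ _ _ (il_comm _ _ _) (il_comm _ _ _)
  have h1 := lin_of_add (fun n => f (il θ n, il θ y) - f (il θ y, il θ n)) (hadd y) x
  have h2 := lin_of_add (fun n => f (il θ n, il θ a0) - f (il θ a0, il θ n)) (hadd a0) y
  have h3 := lin_of_add (fun n => f (il θ n, il θ a1) - f (il θ a1, il θ n)) (hadd a1) y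
  simp only [lin, Matrix.cons_val_zero, Matrix.cons_val_one] at h1 h2 h3
  simp only [om]
  linear_combination h1 - ((x.toAdd 0 : ℤ) : k) * h2 - ((x.toAdd 1 : ℤ) : k) * h3

theorem kappa_det (θ : GL (Fin 2) ℤ) (f : GG θ × GG θ → k) (hf : IsCoc f) :
    ((θ : Matrix (Fin 2) (Fin 2) ℤ).det : ℤ) *
      (f (il θ a0, il θ a1) - f (il θ a1, il θ a0)) =
      f (il θ a0, il θ a1) - f (il θ a1, il θ a0) := by
  have h1 := kappa_conj hf (tt θ) (il θ a0) (il θ a1) _ _ (il_comm _ _ _) (tt_il θ a0) (tt_il θ a1)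
  have h2 := kappa_eq θ f hf (torusAut θ a0) (torusAut θ a1)
  have h3 : (om a0 a1 : k) = 1 := by simp [om, a0, a1]
  rw [h1, om_torusAut, h3] at h2
  linear_combination -h2

theorem key (θ : GL (Fin 2) ℤ) (f : GG θ × GG θ → k) (hf : IsCoc f)
    (hc : f (il θ a0, il θ a1) = f (il θ a1, il θ a0)) :
    ∃ φ h, Bounds h (f - cocLin θ φ) := by
  let A : Ext f hf := ⟨0, il θ a0⟩
  let B : Ext f hf := ⟨0, il θ a1⟩
  let T : Ext f hf := ⟨0, tt θ⟩
  have hA : pi A = il θ a0 := rfl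
  have hB : pi B = il θ a1 := rfl
  have hT : pi T = tt θ := rfl
  have hAB : Commute A B := by
    have := comm_cen A B (il_comm _ _ _)
    rw [hA, hB, hc, sub_self, cen_zero, one_mul] at this
    exact this
  let s : NN →* Ext f hf := MonoidHom.mk' (fun n => A ^ (n.toAdd 0) * B ^ (n.toAdd 1)) (by
    intro n n'
    have := (hAB.zpow_zpow (n'.toAdd 0) (n.toAdd 1)).eq
    simp only [toAdd_mul, Pi.add_apply, zpow_add]
    simp only [mul_assoc]
    rw [← mul_assoc (A ^ _) (B ^ _) (B ^ _), this, mul_assoc])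
  have hs : ∀ n, pi (s n) = il θ n := by
    intro n
    change pi (A ^ (n.toAdd 0) * B ^ (n.toAdd 1)) = _
    rw [map_mul, map_zpow, map_zpow, hA, hB, ← map_zpow, ← map_zpow, ← map_mul, ← basis_eq]
  have hex : ∀ n, ∃ c, T * s n * T⁻¹ = cen c * s (torusAut θ n) := by
    intro n
    apply exists_cen
    rw [map_mul, map_mul, map_inv, hs, hs, hT, tt_il, mul_inv_cancel_right]
  choose ψ hψ using hex
  have hψadd : ∀ n n', ψ (n * n') = ψ n + ψ n' := by
    intro n n'
    have h1 := hψ (n * n')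
    have h2 : T * s (n * n') * T⁻¹ = (T * s n * T⁻¹) * (T * s n' * T⁻¹) := by
      rw [map_mul]; group
    rw [h2, hψ, hψ] at h1
    have h3 : cen (ψ n) * s (torusAut θ n) * (cen (ψ n') * s (torusAut θ n')) =
        cen (ψ n + ψ n') * s (torusAut θ (n * n')) := by
      rw [cen_add, map_mul, map_mul, mul_assoc, mul_assoc, ← mul_assoc (s _) (cen _),
        cen_comm (ψ n') (s _), mul_assoc]
    rw [h3] at h1
    exact (cen_inj (mul_right_cancel h1)).symm
  let φ : Fin 2 → k := ![ψ a0, ψ a1]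
  have hφ : ∀ n, ψ n = lin φ n := lin_of_add ψ hψadd
  have step : ∀ (m : ℤ) (n : NN),
      T * (cen (EE θ φ m n) * s ((torusAut θ ^ m) n)) * T⁻¹ =
      cen (EE θ φ (m + 1) n) * s ((torusAut θ ^ (m + 1)) n) := by
    intro m n
    have e1 : EE θ φ (m + 1) n = EE θ φ m n + lin φ ((torusAut θ ^ m) n) := zs_succ _ _
    rw [e1, cen_add, ← hφ, mul_assoc (cen _) (cen _), add_comm m 1, zpow_add, zpow_one,
      MulAut.mul_apply, ← hψ, ← mul_assoc T, cen_comm]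
    group
  have hpow : ∀ (m : ℤ) (n : NN), T ^ m * s n * (T ^ m)⁻¹ =
      cen (EE θ φ m n) * s ((torusAut θ ^ m) n) := by
    intro m n
    induction m using Int.induction_on with
    | zero => simp [EE_zero, cen_zero]
    | succ i ih =>
      rw [← step, ← ih]; group
    | pred i ih =>
      have h1 := step (-i - 1) n
      rw [sub_add_cancel, ← ih] at h1
      have h2 : T ^ (-(i : ℤ)) * s n * (T ^ (-(i : ℤ)))⁻¹ =
          T * (T ^ (-(i : ℤ) - 1) * s n * (T ^ (-(i : ℤ) - 1))⁻¹) * T⁻¹ := by group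
      rw [h2] at h1
      exact (mul_left_cancel (mul_right_cancel h1)).symm
  let σ : GG θ → Ext f hf := fun g => s g.left * T ^ g.right.toAdd
  have hσ : ∀ g, (σ g).pr = g := by
    intro g
    change pi (s g.left * T ^ g.right.toAdd) = g
    rw [map_mul, hs, map_zpow, hT, decomp]
  have hmul : ∀ g j, σ g * σ j = cen (cocLin θ φ (g, j)) * σ (g * j) := by
    intro g j
    have h1 := hpow g.right.toAdd j.left
    simp only [σ, cocLin_apply, SemidirectProduct.mul_left, SemidirectProduct.mul_right, toAdd_mul,
      action_apply, map_mul]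
    rw [← mul_assoc (cen _), ← mul_assoc (cen _), ← cen_comm, mul_assoc (s g.left) (cen _), ← h1,
      zpow_add]
    group
  refine ⟨φ, fun g => - (σ g).val, ?_⟩
  intro g j
  have h1 := congrArg Ext.val (hmul g j)
  rw [cen_mul_val, mul_val, hσ, hσ] at h1
  simp only [Pi.sub_apply]
  linear_combination h1

theorem lin_ext {φ ψ : Fin 2 → k} (h : ∀ n, lin φ n = lin ψ n) : φ = ψ := by
  funext i
  fin_cases i
  · have := h a0
    rwa [lin_a0, lin_a0] at this
  · have := h a1
    rwa [lin_a1, lin_a1] at this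

/-- The reduction of `θ - 1`. -/
def red (k : Type) [CommRing k] (θ : GL (Fin 2) ℤ) : Matrix (Fin 2) (Fin 2) k :=
  ((θ : Matrix (Fin 2) (Fin 2) ℤ) - 1).map (Int.cast : ℤ → k)

theorem lin_red (θ : GL (Fin 2) ℤ) (η : Fin 2 → k) (n : NN) :
    lin ((red k θ).transpose.mulVecLin η) n = lin η (torusAut θ n) - lin η n := by
  rw [lin_torusAut]
  simp [lin, red, Matrix.mulVec, Matrix.vecMul, dotProduct, Fin.sum_univ_two]
  ring

theorem il_right (θ : GL (Fin 2) ℤ) (n : NN) : (il θ n).right = 1 := rfl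
theorem il_left (θ : GL (Fin 2) ℤ) (n : NN) : (il θ n).left = n := rfl

theorem ker_of_bounds (θ : GL (Fin 2) ℤ) (φ : Fin 2 → k) (h : GG θ → k)
    (hh : Bounds h (cocLin θ φ)) : φ ∈ LinearMap.range (red k θ).transpose.mulVecLin := by
  have h1 : ∀ n n', h (il θ (n * n')) = h (il θ n) + h (il θ n') := by
    intro n n'
    have := hh (il θ n) (il θ n')
    rw [cocLin_apply, il_right, toAdd_one, EE_zero, ← map_mul] at this
    linear_combination this
  have h2 := lin_of_add (fun n => h (il θ n)) h1
  refine ⟨-![h (il θ a0), h (il θ a1)], ?_⟩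
  apply lin_ext
  intro n
  have h3 := hh (tt θ) (il θ n)
  have h4 := hh (il θ (torusAut θ n)) (tt θ)
  rw [← tt_il, cocLin_apply, il_right, toAdd_one, EE_zero] at h4
  have h5 : cocLin θ φ (tt θ, il θ n) = lin φ n := EE_one θ φ n
  rw [h5] at h3
  have hneg : ∀ (ψ : Fin 2 → k) n, lin (-ψ) n = - lin ψ n := by
    intro ψ n; simp [lin]; ring
  rw [lin_red, hneg, hneg, ← h2, ← h2]
  linear_combination h4 - h3

theorem bounds_of_ker (θ : GL (Fin 2) ℤ) (φ : Fin 2 → k)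
    (hφ : φ ∈ LinearMap.range (red k θ).transpose.mulVecLin) :
    ∃ h, Bounds h (cocLin θ φ) := by
  obtain ⟨η, rfl⟩ := hφ
  have hE : ∀ m n, EE θ ((red k θ).transpose.mulVecLin η) m n =
      lin η ((torusAut θ ^ m) n) - lin η n := by
    intro m n
    refine zs_unique _ (fun m => lin η ((torusAut θ ^ m) n) - lin η n) (by simp) ?_ m
    intro m
    rw [lin_red, add_comm m 1, zpow_add, zpow_one, MulAut.mul_apply]
    ring
  refine ⟨fun g => - lin η g.left, ?_⟩
  intro g j
  rw [cocLin_apply, hE]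
  simp only [SemidirectProduct.mul_left, lin_mul, action_apply]
  ring

theorem cocDet_a (θ : GL (Fin 2) ℤ) (u c : k) (hu : u + u = 1) :
    cocDet θ u c (il θ a0, il θ a1) - cocDet θ u c (il θ a1, il θ a0) = c := by
  simp only [cocDet_apply, il_right, il_left, toAdd_one, zpow_zero, MulAut.one_apply]
  simp [om, a0, a1]
  linear_combination c * hu

theorem cocLin_il (θ : GL (Fin 2) ℤ) (φ : Fin 2 → k) (n n' : NN) :
    cocLin θ φ (il θ n, il θ n') = 0 := EE_zero θ φ n'

end

theorem finrank_red {k : Type} [Field k] (θ : GL (Fin 2) ℤ) :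
    Module.finrank k (LinearMap.range (red k θ).transpose.mulVecLin) = (red k θ).rank := by
  rw [← Matrix.rank_transpose]; rfl

theorem IsCoc.sub {G k : Type*} [Group G] [AddCommGroup k] {f f' : G × G → k} (hf : IsCoc f)
    (hf' : IsCoc f') : IsCoc (f - f') := by
  intro g h j
  have h1 := eq_sub_of_add_eq (hf g h j)
  have h2 := eq_sub_of_add_eq (hf' g h j)
  simp only [Pi.sub_apply]
  rw [h1, h2]; abel

theorem IsCoc.add {G k : Type*} [Group G] [AddCommGroup k] {f f' : G × G → k} (hf : IsCoc f)
    (hf' : IsCoc f') : IsCoc (f + f') := by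
  intro g h j
  have h1 := eq_sub_of_add_eq (hf g h j)
  have h2 := eq_sub_of_add_eq (hf' g h j)
  simp only [Pi.add_apply]
  rw [h1, h2]; abel

theorem case_neg {k : Type} [Field k] (h2 : (2 : k) ≠ 0) (θ : GL (Fin 2) ℤ)
    (hd : (θ : Matrix (Fin 2) (Fin 2) ℤ).det = -1) :
    Nonempty (groupCohomology (Rep.trivial k (GG θ) k) 2 ≃+ (Fin (2 - (red k θ).rank) → k)) := by
  refine H2_equiv (cocLin θ) (cocLin_coc θ) ?_ (LinearMap.range (red k θ).transpose.mulVecLin)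
    ?_ _ ?_
  · intro f hf
    apply key θ f hf
    have := kappa_det θ f hf
    rw [hd] at this
    push_cast at this
    have h3 : (2 : k) * (f (il θ a0, il θ a1) - f (il θ a1, il θ a0)) = 0 := by
      linear_combination -this
    exact sub_eq_zero.1 ((mul_eq_zero.1 h3).resolve_left h2)
  · exact fun φ => ⟨bounds_of_ker θ φ, fun ⟨h, hh⟩ => ker_of_bounds θ φ h hh⟩
  · rw [finrank_red]
    have := Matrix.rank_le_width (red k θ)
    simp only [Module.finrank_fin_fun]
    omega

theorem case_pos {k : Type} [Field k] (h2 : (2 : k) ≠ 0) (θ : GL (Fin 2) ℤ)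
    (hd : (θ : Matrix (Fin 2) (Fin 2) ℤ).det = 1) :
    Nonempty (groupCohomology (Rep.trivial k (GG θ) k) 2 ≃+ (Fin (3 - (red k θ).rank) → k)) := by
  have hu : (2⁻¹ : k) + 2⁻¹ = 1 := by rw [← two_mul, mul_inv_cancel₀ h2]
  have hinj : Function.Injective (LinearMap.inr k k (Fin 2 → k)) := LinearMap.inr_injective
  have hF : ∀ w : k × (Fin 2 → k), ((cocDet θ (2⁻¹ : k)).coprod (cocLin θ)) w =
      cocDet θ (2⁻¹ : k) w.1 + cocLin θ w.2 := fun w => LinearMap.coprod_apply _ _ _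
  refine H2_equiv (W := k × (Fin 2 → k)) ((cocDet θ (2⁻¹ : k)).coprod (cocLin θ)) ?_ ?_
    ((LinearMap.range (red k θ).transpose.mulVecLin).map (LinearMap.inr k k (Fin 2 → k)))
    ?_ _ ?_
  · intro w
    rw [hF]
    exact (cocDet_coc θ hd _ _).add (cocLin_coc θ _)
  · intro f hf
    let c := f (il θ a0, il θ a1) - f (il θ a1, il θ a0)
    obtain ⟨φ, h, hh⟩ := key θ (f - cocDet θ (2⁻¹ : k) c) (hf.sub (cocDet_coc θ hd _ _)) (by
      have := cocDet_a θ (2⁻¹ : k) c hu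
      simp only [Pi.sub_apply]
      linear_combination -this)
    refine ⟨(c, φ), h, ?_⟩
    rw [hF, ← sub_sub]
    exact hh
  · rintro ⟨c, φ⟩
    rw [hF]
    constructor
    · rintro ⟨ψ, hψ, e⟩
      obtain ⟨rfl, rfl⟩ := Prod.mk.inj e
      simpa using bounds_of_ker θ ψ hψ
    · rintro ⟨h, hh⟩
      have hc : c = 0 := by
        have h1 := hh (il θ a0) (il θ a1)
        have h2 := hh (il θ a1) (il θ a0)
        rw [il_comm θ a1 a0] at h2
        simp only [Pi.add_apply, cocLin_il] at h1 h2
        have := cocDet_a θ (2⁻¹ : k) c hu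
        linear_combination h1 - h2 - this
      subst hc
      refine ⟨φ, ker_of_bounds θ φ h ?_, rfl⟩
      simpa using hh
  · rw [← (Submodule.equivMapOfInjective _ hinj _).finrank_eq, finrank_red]
    have := Matrix.rank_le_width (red k θ)
    simp only [Module.finrank_prod, Module.finrank_self, Module.finrank_fin_fun]
    omega

end TB

/-- For an odd prime `p`: if `det θ = 1` then `H²(G, 𝔽_p) ≅ 𝔽_p^(3 - r_p)`, and if
`det θ = -1` then `H²(G, 𝔽_p) ≅ 𝔽_p^(2 - r_p)`, where `r_p` is the rank of `θ - I`
reduced mod `p`. -/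
theorem torusBundle_H2_modp (θ : GL (Fin 2) ℤ) (p : ℕ) (hp : p.Prime) (hodd : Odd p)
    (r_p : ℕ) (hr : (((θ : Matrix (Fin 2) (Fin 2) ℤ) - 1).map (Int.cast : ℤ → ZMod p)).rank = r_p) :
    ((θ : Matrix (Fin 2) (Fin 2) ℤ).det = 1 →
      Nonempty ((groupCohomology (Rep.trivial (ZMod p) (TorusBundleGroup θ) (ZMod p)) 2) ≃+
        (Fin (3 - r_p) → ZMod p))) ∧
    ((θ : Matrix (Fin 2) (Fin 2) ℤ).det = -1 →
      Nonempty ((groupCohomology (Rep.trivial (ZMod p) (TorusBundleGroup θ) (ZMod p)) 2) ≃+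
        (Fin (2 - r_p) → ZMod p))) := by
  have : Fact p.Prime := ⟨hp⟩
  have h2 : (2 : ZMod p) ≠ 0 := by
    intro h
    have h3 : ((2 : ℕ) : ZMod p) = 0 := by exact_mod_cast h
    rw [ZMod.natCast_eq_zero_iff] at h3
    have h4 := (Nat.prime_dvd_prime_iff_eq hp Nat.prime_two).1 h3
    subst h4
    exact absurd hodd (by decide)
  subst hr
  exact ⟨fun hd => TB.case_pos h2 θ hd, fun hd => TB.case_neg h2 θ hd⟩
end

section
/- Let p be an odd prime. If det θ = 1 then H³(G, 𝔽_p) ≅ 𝔽_p, and if det θ = −1 then H³(G, 𝔽_p) ≅ 0. -/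
open CategoryTheory

namespace TorusB

section
variable {k G : Type} [Field k] [Group G] (π : G →* Multiplicative ℤ)

/-- `ℤ → k` with `G` acting by translation through `π`. -/
def shiftRho : Representation k G (ℤ → k) where
  toFun g := LinearMap.funLeft k k (fun m : ℤ => m + (π g).toAdd)
  map_one' := by ext f m; simp [LinearMap.funLeft]
  map_mul' g h := by
    ext f m; simp [LinearMap.funLeft, add_assoc]

@[simp] lemma shiftRho_apply (g : G) (f : ℤ → k) (m : ℤ) :
    shiftRho π g f m = f (m + (π g).toAdd) := rfl

/-- The representation. -/
abbrev shiftRep : Rep k G := Rep.of (shiftRho (k := k) π)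

/-- difference operator -/
def diffLin : (ℤ → k) →ₗ[k] (ℤ → k) :=
  LinearMap.funLeft k k (fun m : ℤ => m + 1) - LinearMap.id

@[simp] lemma diffLin_apply (f : ℤ → k) (m : ℤ) : diffLin f m = f (m+1) - f m := rfl

/-- constants -/
def constLin : k →ₗ[k] (ℤ → k) where
  toFun c := fun _ => c
  map_add' _ _ := rfl
  map_smul' _ _ := rfl

lemma diff_surj : Function.Surjective (diffLin (k := k)) := by
  intro g
  refine ⟨fun m => ∑ i ∈ Finset.Ico 0 m, g i - ∑ i ∈ Finset.Ico m 0, g i, ?_⟩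
  ext m
  simp only [diffLin_apply]
  rcases le_or_gt 0 m with h | h
  · have h1 : Finset.Ico m 0 = ∅ := by simp [h]
    have h2 : Finset.Ico (m+1) 0 = ∅ := by simp; omega
    have h3 : Finset.Ico 0 (m+1) = insert m (Finset.Ico 0 m) := by ext; simp; omega
    rw [h1, h2, h3, Finset.sum_insert (by simp)]; simp
  · have h1 : Finset.Ico 0 m = ∅ := by simp; omega
    have h2 : Finset.Ico 0 (m+1) = ∅ := by simp; omega
    have h3 : Finset.Ico m 0 = insert m (Finset.Ico (m+1) 0) := by ext; simp; omega
    rw [h1, h2, h3, Finset.sum_insert (by simp)]; simp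

lemma diff_ker (f : ℤ → k) (h : diffLin f = 0) : ∃ c, constLin c = f := by
  have h' : ∀ m, f (m+1) = f m := fun m => by
    have := congrFun h m
    simpa [sub_eq_zero] using this
  refine ⟨f 0, ?_⟩
  ext m
  change f 0 = f m
  induction m using Int.induction_on with
  | zero => rfl
  | succ i ih => rw [h', ih]
  | pred i ih => rw [ih, ← h' (-(i:ℤ) - 1)]; simp

/-- constants, as a morphism -/
noncomputable def constHom : Rep.trivial k G k ⟶ shiftRep (k := k) π :=
  Rep.ofHom ⟨constLin, fun g => by ext; rfl⟩

/-- difference, as a morphism -/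
noncomputable def diffHom : shiftRep (k := k) π ⟶ shiftRep (k := k) π :=
  Rep.ofHom ⟨diffLin, fun g => by
    ext f m
    simp [add_right_comm]⟩

/-- the short complex -/
noncomputable def sc : ShortComplex (Rep k G) where
  X₁ := Rep.trivial k G k
  X₂ := shiftRep π
  X₃ := shiftRep π
  f := constHom π
  g := diffHom π
  zero := by
    ext m
    change (1:k) - 1 = 0
    simp

lemma sc_shortExact : (sc (k := k) π).ShortExact where
  exact := by
    refine (forget₂ (Rep k G) (ModuleCat k)).reflects_exact_of_faithful _ <|
      (ShortComplex.moduleCat_exact_iff _).2 fun x hx => ?_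
    exact diff_ker x hx
  mono_f := (Rep.mono_iff_injective _).2 fun a b h => congrFun h 0
  epi_g := (Rep.epi_iff_surjective _).2 diff_surj

/-- Identification with the coinduced module. -/
noncomputable def coindEquiv (hπ : Function.Surjective π) :
    (ℤ → k) ≃ₗ[k] Representation.coindV π.ker.subtype (Rep.trivial k π.ker k).ρ where
  toFun f := ⟨fun g => f (π g).toAdd, fun n h => by
    have : π n = 1 := n.2
    simp [this]⟩
  map_add' _ _ := rfl
  map_smul' _ _ := rfl
  invFun F m := F.1 (Function.surjInv hπ (Multiplicative.ofAdd m))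
  left_inv f := by ext m; simp [Function.surjInv_eq]
  right_inv F := by
    ext g
    have h := F.2 ⟨Function.surjInv hπ (π g) * g⁻¹, by
      rw [MonoidHom.mem_ker]; simp [Function.surjInv_eq]⟩ g
    simpa using h

/-- The Shapiro isomorphism. -/
noncomputable def shapiro (hπ : Function.Surjective π) (n : ℕ) :
    groupCohomology (shiftRep (k := k) π) n ≅ groupCohomology (Rep.trivial k π.ker k) n :=
  groupCohomology.mapIso (MulEquiv.refl G) (coindEquiv π hπ) (fun g => by
    ext f h
    change f ((π h).toAdd + (π g).toAdd) = f (π (h * g)).toAdd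
    simp) n ≪≫ groupCohomology.coindIso (Rep.trivial k π.ker k) n

/-- rank of cohomology -/
noncomputable abbrev rk (k G : Type) [Field k] [Group G] (n : ℕ) : Cardinal :=
  Module.rank k (groupCohomology (Rep.trivial k G k) n)

lemma rk_shift (hπ : Function.Surjective π) (n : ℕ) :
    Module.rank k (groupCohomology (shiftRep (k := k) π) n) = rk k π.ker n :=
  (shapiro π hπ n).toLinearEquiv.rank_eq

lemma rank_le_of_exact (S : ShortComplex (ModuleCat.{0} k)) (h : S.Exact) :
    Module.rank k S.X₂ ≤ Module.rank k S.X₁ + Module.rank k S.X₃ := by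
  rw [← LinearMap.rank_range_add_rank_ker S.g.hom, ← h.moduleCat_range_eq_ker, add_comm]
  gcongr
  · exact rank_range_le _
  · exact Submodule.rank_le _

lemma rk_succ_le (hπ : Function.Surjective π) (n : ℕ) :
    rk k G (n+1) ≤ rk k π.ker n + rk k π.ker (n+1) := by
  have := rank_le_of_exact _ (groupCohomology.mapShortComplex₁_exact (sc_shortExact (k := k) π)
    (i := n) rfl)
  rw [← rk_shift π hπ n, ← rk_shift π hπ (n+1)]
  exact this

lemma rk_zero : rk k G 0 = 1 := by
  rw [rk, (groupCohomology.H0IsoOfIsTrivial (Rep.trivial k G k)).toLinearEquiv.rank_eq]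
  exact Module.rank_self k

lemma rk_subsingleton [Subsingleton G] (n : ℕ) : rk k G (n+1) = 0 := by
  have := isZero_groupCohomology_succ_of_subsingleton (Rep.trivial k G k) n
  have := ModuleCat.subsingleton_of_isZero this
  exact rank_subsingleton' _ _

lemma rk_Z (hi : Function.Injective π) (hπ : Function.Surjective π) :
    rk k G 1 ≤ 1 ∧ ∀ n, rk k G (n+2) = 0 := by
  have : Subsingleton π.ker := by
    rw [(MonoidHom.ker_eq_bot_iff π).2 hi]; infer_instance
  constructor
  · refine (rk_succ_le π hπ 0).trans ?_
    rw [rk_subsingleton, rk_zero]; simp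
  · intro n
    have := rk_succ_le (k := k) π hπ (n+1)
    rw [rk_subsingleton (G := π.ker), rk_subsingleton (G := π.ker)] at this
    simpa using this

lemma rk_Z2 (hπ : Function.Surjective π) (π' : π.ker →* Multiplicative ℤ)
    (hi : Function.Injective π') (hs : Function.Surjective π') :
    rk k G 2 ≤ 1 ∧ rk k G 3 = 0 := by
  obtain ⟨h1, h2⟩ := rk_Z (k := k) π' hi hs
  constructor
  · refine (rk_succ_le π hπ 1).trans ?_
    rw [h2 0]; simpa using h1
  · have := rk_succ_le (k := k) π hπ 2
    rw [h2 0, h2 1] at this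
    simpa using this

open groupCohomology in
/-- Main abstract computation. -/
lemma abstract_H3 (hπ : Function.Surjective π) (h2 : rk k π.ker 2 ≤ 1) (h3 : rk k π.ker 3 = 0)
    (f : cocycles₂ (shiftRep (k := k) π)) (ε : k)
    (hε : ∀ x m, f x (m + 1) = ε * f x m)
    (hf : ⇑f ∉ coboundaries₂ (shiftRep (k := k) π)) :
    (ε = 1 → Nonempty (groupCohomology (Rep.trivial k G k) 3 ≃ₗ[k] k)) ∧
    (ε ≠ 1 → Subsingleton (groupCohomology (Rep.trivial k G k) 3)) := by
  have hX := sc_shortExact (k := k) π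
  have hs3 : Subsingleton (groupCohomology (shiftRep (k := k) π) 3) := by
    rw [← rank_zero_iff (R := k), rk_shift π hπ, h3]
  have hδs : Function.Surjective (δ hX 2 3 rfl) := by
    intro x
    exact (ShortComplex.moduleCat_exact_iff _).1 (mapShortComplex₁_exact hX (i := 2) rfl) x
      (hs3.elim _ _)
  set c : groupCohomology (shiftRep (k := k) π) 2 := H2π _ f with hc
  have hc0 : c ≠ 0 := fun h => hf ((H2π_eq_zero_iff f).1 h)
  have hspan : ∀ x : groupCohomology (shiftRep (k := k) π) 2, ∃ a : k, a • c = x := by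
    have h2' : Module.rank k (groupCohomology (shiftRep (k := k) π) 2) ≤ 1 := by
      rw [rk_shift π hπ]; exact h2
    obtain ⟨v, hv⟩ := rank_le_one_iff.1 h2'
    intro x
    obtain ⟨a, ha⟩ := hv c
    obtain ⟨b, hb⟩ := hv x
    have : a ≠ 0 := by rintro rfl; apply hc0; rw [← ha, zero_smul]
    refine ⟨b * a⁻¹, ?_⟩
    rw [← ha, smul_smul, mul_assoc, inv_mul_cancel₀ this, mul_one, hb]
  have hDc : map (A := shiftRep (k := k) π) (B := shiftRep (k := k) π)
        (MonoidHom.id G) (diffHom (k := k) π) 2 c = (ε - 1) • c := by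
    rw [hc, ← map_smul]
    have := H2π_comp_map_apply (MonoidHom.id G) (diffHom (k := k) π) f
    refine this.trans ?_
    congr 1
    apply cocycles₂_ext
    intro g h
    ext m
    change f (g,h) (m+1) - f (g,h) m = (ε - 1) * f (g,h) m
    rw [hε]; ring
  have hex := (ShortComplex.moduleCat_exact_iff _).1 (mapShortComplex₃_exact hX (i := 2) rfl)
  have hzero : ∀ x, δ hX 2 3 rfl (map (A := shiftRep (k := k) π) (B := shiftRep (k := k) π)
        (MonoidHom.id G) (diffHom (k := k) π) 2 x) = 0 := by
    intro x
    exact (ShortComplex.moduleCat_zero_apply (mapShortComplex₃ hX (i := 2) rfl) x)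
  constructor
  · rintro rfl
    have hD0 : ∀ x, map (A := shiftRep (k := k) π) (B := shiftRep (k := k) π)
        (MonoidHom.id G) (diffHom (k := k) π) 2 x = 0 := by
      intro x
      obtain ⟨a, rfl⟩ := hspan x
      rw [map_smul, hDc]; simp
    have hδc : δ hX 2 3 rfl c ≠ 0 := by
      intro h
      obtain ⟨y, hy⟩ := hex c h
      exact hc0 (hy.symm.trans (hD0 y))
    refine ⟨(LinearEquiv.ofBijective
      (LinearMap.toSpanSingleton k _ (δ hX 2 3 rfl c)) ⟨?_, ?_⟩).symm⟩
    · rw [← LinearMap.ker_eq_bot, LinearMap.ker_toSpanSingleton k hδc]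
    · intro y
      obtain ⟨x, rfl⟩ := hδs y
      obtain ⟨a, rfl⟩ := hspan x
      exact ⟨a, (map_smul (δ hX 2 3 rfl).hom a c).symm⟩
  · intro hne
    have hne' : ε - 1 ≠ 0 := sub_ne_zero.2 hne
    refine subsingleton_of_forall_eq 0 fun y => ?_
    obtain ⟨x, rfl⟩ := hδs y
    obtain ⟨a, rfl⟩ := hspan x
    have : a • c = map (A := shiftRep (k := k) π) (B := shiftRep (k := k) π)
        (MonoidHom.id G) (diffHom (k := k) π) 2 ((a * (ε - 1)⁻¹) • c) := by
      rw [map_smul, hDc, smul_smul, mul_assoc, inv_mul_cancel₀ hne', mul_one]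
    rw [this]
    exact hzero _
end

/-- symplectic form -/
def om (a b : Multiplicative (Fin 2 → ℤ)) : ℤ :=
  a.toAdd 0 * b.toAdd 1 - a.toAdd 1 * b.toAdd 0

lemma om_mul_left (a b c) : om (a * b) c = om a c + om b c := by
  simp [om]; ring

lemma om_mul_right (a b c) : om a (b * c) = om a b + om a c := by
  simp [om]; ring

lemma om_self (a) : om a a = 0 := by simp [om]; ring

lemma torusAut_apply (θ : GL (Fin 2) ℤ) (a : Multiplicative (Fin 2 → ℤ)) :
    (torusAut θ a).toAdd = (θ : Matrix (Fin 2) (Fin 2) ℤ).mulVec a.toAdd := rfl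

lemma om_aut (θ : GL (Fin 2) ℤ) (a b : Multiplicative (Fin 2 → ℤ)) :
    om (torusAut θ a) (torusAut θ b) = (Matrix.GeneralLinearGroup.det θ : ℤ) * om a b := by
  simp only [om, torusAut_apply, Matrix.GeneralLinearGroup.val_det_apply, Matrix.det_fin_two,
    Matrix.mulVec, dotProduct, Fin.sum_univ_two]
  ring

lemma om_zpow (θ : GL (Fin 2) ℤ) (n : ℤ) (a b : Multiplicative (Fin 2 → ℤ)) :
    om ((torusAut θ ^ n) a) ((torusAut θ ^ n) b)
      = ((Matrix.GeneralLinearGroup.det θ ^ n : ℤˣ) : ℤ) * om a b := by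
  induction n using Int.induction_on with
  | zero => simp
  | succ i ih =>
    rw [add_comm, zpow_add, zpow_add, zpow_one, zpow_one, MulAut.mul_apply, MulAut.mul_apply,
      om_aut, ih, Units.val_mul, mul_assoc]
  | pred i ih =>
    have h := om_aut θ ((torusAut θ ^ (-(i:ℤ) - 1)) a) ((torusAut θ ^ (-(i:ℤ) - 1)) b)
    have e : torusAut θ ^ (-(i:ℤ)) = torusAut θ * torusAut θ ^ (-(i:ℤ) - 1) := by
      rw [← zpow_one_add]; congr 1; ring
    have e' : (Matrix.GeneralLinearGroup.det θ) ^ (-(i:ℤ)) =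
        Matrix.GeneralLinearGroup.det θ * Matrix.GeneralLinearGroup.det θ ^ (-(i:ℤ) - 1) := by
      rw [← zpow_one_add]; congr 1; ring
    rw [← MulAut.mul_apply, ← MulAut.mul_apply, ← e, ih, e', Units.val_mul, mul_assoc] at h
    exact ((Units.isUnit (Matrix.GeneralLinearGroup.det θ)).mul_left_cancel h).symm

section torus
variable (θ : GL (Fin 2) ℤ)

/-- projection -/
noncomputable def proj : TorusBundleGroup θ →* Multiplicative ℤ :=
  SemidirectProduct.rightHom (φ := torusAction θ)

lemma proj_surj : Function.Surjective (proj θ) := SemidirectProduct.rightHom_surjective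

/-- the `ℤ²` component -/
noncomputable def lft (g : TorusBundleGroup θ) : Multiplicative (Fin 2 → ℤ) :=
  SemidirectProduct.left (φ := torusAction θ) g

/-- inclusion of `ℤ²` -/
noncomputable def incl : Multiplicative (Fin 2 → ℤ) →* TorusBundleGroup θ :=
  SemidirectProduct.inl (φ := torusAction θ)

@[simp] lemma proj_incl (a) : proj θ (incl θ a) = 1 := rfl
@[simp] lemma lft_incl (a) : lft θ (incl θ a) = a := rfl

lemma lft_mul (g h : TorusBundleGroup θ) :
    lft θ (g * h) = lft θ g * (torusAut θ ^ (proj θ g).toAdd) (lft θ h) := rfl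

lemma ext_tb (g h : TorusBundleGroup θ) (h1 : lft θ g = lft θ h) (h2 : proj θ g = proj θ h) :
    g = h := SemidirectProduct.ext h1 h2

/-- first coordinate on the kernel -/
noncomputable def pr0 : (proj θ).ker →* Multiplicative ℤ where
  toFun g := Multiplicative.ofAdd ((lft θ g.1).toAdd 0)
  map_one' := rfl
  map_mul' g h := by
    have : proj θ g.1 = 1 := g.2
    simp [lft_mul, this]

/-- second coordinate on the kernel of the first -/
noncomputable def pr1 : (pr0 θ).ker →* Multiplicative ℤ where
  toFun g := Multiplicative.ofAdd ((lft θ g.1.1).toAdd 1)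
  map_one' := rfl
  map_mul' g h := by
    have : proj θ g.1.1 = 1 := g.1.2
    simp [lft_mul, this]

lemma pr0_surj : Function.Surjective (pr0 θ) := fun m =>
  ⟨⟨incl θ (Multiplicative.ofAdd ![m.toAdd, 0]), proj_incl θ _⟩, rfl⟩

lemma pr1_surj : Function.Surjective (pr1 θ) := fun m =>
  ⟨⟨⟨incl θ (Multiplicative.ofAdd ![0, m.toAdd]), proj_incl θ _⟩, rfl⟩, rfl⟩

lemma pr1_inj : Function.Injective (pr1 θ) := by
  intro g h hgh
  apply Subtype.ext
  apply Subtype.ext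
  apply ext_tb
  · apply Multiplicative.toAdd.injective
    ext i
    fin_cases i
    · have h1 : (lft θ g.1.1).toAdd 0 = 0 := g.2
      have h2 : (lft θ h.1.1).toAdd 0 = 0 := h.2
      exact h1.trans h2.symm
    · exact hgh
  · exact g.1.2.trans (Eq.symm h.1.2)

open groupCohomology in
/-- the explicit cocycle -/
noncomputable def cocyc (k : Type) [Field k] : cocycles₂ (shiftRep (k := k) (proj θ)) :=
  ⟨fun x m => ((((Matrix.GeneralLinearGroup.det θ ^ m : ℤˣ) : ℤ) *
      om (lft θ x.1) ((torusAut θ ^ (proj θ x.1).toAdd) (lft θ x.2)) : ℤ) : k), by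
    rw [mem_cocycles₂_iff]
    intro g h j
    ext m
    change (Int.cast _ : k) + Int.cast _ = Int.cast _ + Int.cast _
    rw [← Int.cast_add, ← Int.cast_add]
    congr 1
    simp only [lft_mul, map_mul, toAdd_mul, om_mul_left, om_mul_right, zpow_add,
      MulAut.mul_apply, om_zpow, Units.val_mul]
    ring⟩

open groupCohomology in
lemma cocyc_apply (k : Type) [Field k] (x : TorusBundleGroup θ × TorusBundleGroup θ) (m : ℤ) :
    cocyc θ k x m = ((((Matrix.GeneralLinearGroup.det θ ^ m : ℤˣ) : ℤ) *
      om (lft θ x.1) ((torusAut θ ^ (proj θ x.1).toAdd) (lft θ x.2)) : ℤ) : k) := rfl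

open groupCohomology in
lemma cocyc_not_mem (k : Type) [Field k] (hk : (2 : k) ≠ 0) :
    ⇑(cocyc θ k) ∉ coboundaries₂ (shiftRep (k := k) (proj θ)) := by
  rintro ⟨u, hu⟩
  let a := incl θ (Multiplicative.ofAdd ![1, 0])
  let b := incl θ (Multiplicative.ofAdd ![0, 1])
  have hab : a * b = b * a := by simp only [a, b, ← map_mul, mul_comm]
  have h1 := congrFun (congrFun hu (a, b)) 0
  have h2 := congrFun (congrFun hu (b, a)) 0
  have e1 : cocyc θ k (a, b) 0 = 1 := by
    rw [cocyc_apply]; simp [a, b, om]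
  have e2 : cocyc θ k (b, a) 0 = -1 := by
    rw [cocyc_apply]; simp [a, b, om]
  rw [e1] at h1
  rw [e2] at h2
  change u b (0 + 0) - u (a * b) 0 + u a 0 = 1 at h1
  change u a (0 + 0) - u (b * a) 0 + u b 0 = -1 at h2
  rw [hab] at h1
  apply hk
  simp only [add_zero] at h1 h2
  linear_combination h2 - h1

end torus
end TorusB

/-- For an odd prime `p`: if `det θ = 1` then `H³(G, 𝔽_p) ≅ 𝔽_p`, and if
`det θ = -1` then `H³(G, 𝔽_p) = 0`. -/
theorem torusBundle_H3_modp (θ : GL (Fin 2) ℤ) (p : ℕ) (hp : p.Prime) (hodd : Odd p) :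
    ((θ : Matrix (Fin 2) (Fin 2) ℤ).det = 1 →
      Nonempty ((groupCohomology (Rep.trivial (ZMod p) (TorusBundleGroup θ) (ZMod p)) 3) ≃+ ZMod p)) ∧
    ((θ : Matrix (Fin 2) (Fin 2) ℤ).det = -1 →
      Subsingleton (groupCohomology (Rep.trivial (ZMod p) (TorusBundleGroup θ) (ZMod p)) 3)) := by
  haveI : Fact p.Prime := ⟨hp⟩
  have h2 : (2 : ZMod p) ≠ 0 := by
    intro h
    have h' : ((2 : ℕ) : ZMod p) = 0 := by exact_mod_cast h
    rw [ZMod.natCast_eq_zero_iff] at h'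
    have := (Nat.prime_dvd_prime_iff_eq hp Nat.prime_two).1 h'
    subst this
    exact absurd hodd (by decide)
  obtain ⟨hr2, hr3⟩ := TorusB.rk_Z2 (k := ZMod p) (TorusB.pr0 θ) (TorusB.pr0_surj θ)
    (TorusB.pr1 θ) (TorusB.pr1_inj θ) (TorusB.pr1_surj θ)
  obtain ⟨hA, hB⟩ := TorusB.abstract_H3 (TorusB.proj θ) (TorusB.proj_surj θ) hr2 hr3
    (TorusB.cocyc θ (ZMod p)) (((Matrix.GeneralLinearGroup.det θ : ℤˣ) : ℤ) : ZMod p)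
    (fun x m => by
      rw [TorusB.cocyc_apply, TorusB.cocyc_apply, zpow_add_one, Units.val_mul]
      push_cast
      ring)
    (TorusB.cocyc_not_mem θ (ZMod p) h2)
  rw [Matrix.GeneralLinearGroup.val_det_apply] at hA hB
  refine ⟨fun h => ?_, fun h => ?_⟩
  · obtain ⟨e⟩ := hA (by rw [h]; simp)
    exact ⟨e.toAddEquiv⟩
  · apply hB
    rw [h]
    intro h'
    apply h2
    push_cast at h'
    linear_combination -h'
end
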